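/- arXiv:2106.02262 — 2 statements merged into one kernel-verified Lean document; each statement's English description precedes it below -/
import Mathlib

section
/- Let q = p^k with p prime and k a positive integer, and let G be the additive group (ℤ_p)^k, so |G| = q. Fix a bijection η : [q] → G and let G act on the chessboard complex Δ_{2q−1,q} by g·(r,j) = (r, η⁻¹(g + η(j))), and on the standard simplex Δ^G (with vertex set {e_g : g ∈ G} ⊂ ℝ^G) by affinely extending g'·e_g = e_{g+g'}. Then for every G-equivariant continuous map f from the geometric realization ‖Δ_{2q−1,q}‖ to Δ^G, there exists a point x₀ ∈ ‖Δ_{2q−1,q}‖ such that f(x₀) = (1/q)·Σ_{g∈G} e_g (the barycenter of Δ^G). -/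
/-- A point of the (canonical geometric realization of the) chessboard complex
`Δ_{2q−1,q}`: barycentric coordinates indexed by `[2q−1] × [q]`, nonnegative, summing to `1`,
whose support is a set of pairwise non-attacking rooks. -/
def chessSpace (q : ℕ) : Set ((Fin (2 * q - 1) × Fin q) → ℝ) :=
  {x | (∀ v, 0 ≤ x v) ∧ (∑ v, x v = 1) ∧
    ∀ v w, x v ≠ 0 → x w ≠ 0 → (v.1 = w.1 ∨ v.2 = w.2) → v = w}

/-! ### Ordered chains

`List V →₀ R` is the augmented complex of ordered tuples of elements of `V`; the empty list spans
the augmentation degree. -/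

namespace OrderedChain

open Finsupp

section Basic

variable {R : Type*} [CommRing R] {V W M : Type*} [AddCommGroup M] [Module R M]

/-- The cone over a chain with apex `v`. -/
noncomputable def cone (v : V) : (List V →₀ R) →ₗ[R] (List V →₀ R) :=
  lmapDomain R R (List.cons v)

/-- The map of chains induced by a map of vertices. -/
noncomputable def map (a : V → W) : (List V →₀ R) →ₗ[R] (List W →₀ R) :=
  lmapDomain R R (List.map a)

/-- The boundary of a tuple. -/
noncomputable def face : List V → (List V →₀ R)
  | [] => 0
  | v :: s => single s 1 - cone v (face s)

/-- The boundary operator. -/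
noncomputable def bd : (List V →₀ R) →ₗ[R] (List V →₀ R) :=
  linearCombination R face

@[simp] lemma cone_single (v : V) (s : List V) (r : R) :
    cone v (single s r) = single (v :: s) r := by
  simp [cone, mapDomain_single]

@[simp] lemma map_single (a : V → W) (s : List V) (r : R) :
    map a (single s r) = single (s.map a) r := by
  simp [map, mapDomain_single]

@[simp] lemma bd_single (s : List V) : bd (single s (1 : R)) = face s := by
  simp [bd]

lemma map_cone (a : V → W) (v : V) (c : List V →₀ R) :
    map a (cone v c) = cone (a v) (map a c) := by
  have : (map a ∘ₗ cone v : (List V →₀ R) →ₗ[R] _) = cone (a v) ∘ₗ map a := by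
    ext s; simp
  exact LinearMap.congr_fun this c

lemma bd_cone (v : V) (c : List V →₀ R) : bd (cone v c) = c - cone v (bd c) := by
  have : (bd ∘ₗ cone v : (List V →₀ R) →ₗ[R] _) = LinearMap.id - cone v ∘ₗ bd := by
    refine Finsupp.lhom_ext' fun s => LinearMap.ext_ring ?_
    simp [face]
  exact LinearMap.congr_fun this c

lemma bd_face (s : List V) : bd (face s : List V →₀ R) = 0 := by
  induction s with
  | nil => simp [face]
  | cons v s ih => simp [face, bd_cone, ih]

lemma map_face (a : V → W) (s : List V) : map a (face s : List V →₀ R) = face (s.map a) := by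
  induction s with
  | nil => simp [face]
  | cons v s ih => simp [face, map_cone, ih]

lemma map_bd (a : V → W) (c : List V →₀ R) : map a (bd c) = bd (map a c) := by
  have : (map a ∘ₗ bd : (List V →₀ R) →ₗ[R] _) = bd ∘ₗ map a := by
    refine Finsupp.lhom_ext' fun s => LinearMap.ext_ring ?_
    simp [map_face]
  exact LinearMap.congr_fun this c

lemma map_map {U : Type*} (b : W → U) (a : V → W) (c : List V →₀ R) :
    map b (map a c) = map (b ∘ a) c := by
  have : (map b ∘ₗ map a : (List V →₀ R) →ₗ[R] _) = map (b ∘ a) := by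
    refine Finsupp.lhom_ext' fun s => LinearMap.ext_ring ?_
    simp
  exact LinearMap.congr_fun this c

lemma mem_of_supported {S : Set (List V)} (L : (List V →₀ R) →ₗ[R] M) (N : Submodule R M)
    (h : ∀ s ∈ S, L (single s 1) ∈ N) {c : List V →₀ R} (hc : c ∈ supported R R S) :
    L c ∈ N := by
  rw [supported_eq_span_single] at hc
  have : Submodule.span R ((fun i => single i (1 : R)) '' S) ≤ N.comap L := by
    rw [Submodule.span_le]
    rintro _ ⟨s, hs, rfl⟩
    exact h s hs
  exact this hc

lemma eq_of_supported {S : Set (List V)} {L L' : (List V →₀ R) →ₗ[R] M}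
    (h : ∀ s ∈ S, L (single s 1) = L' (single s 1)) {c : List V →₀ R}
    (hc : c ∈ supported R R S) : L c = L' c := by
  have := mem_of_supported (L - L') ⊥ (by simpa [sub_eq_zero] using h) hc
  simpa [sub_eq_zero] using this

lemma cone_mem_supported {S T : Set (List V)} {v : V} (h : ∀ s ∈ S, v :: s ∈ T)
    {c : List V →₀ R} (hc : c ∈ supported R R S) : cone v c ∈ supported R R T :=
  mem_of_supported _ _ (fun s hs => by simpa using single_mem_supported R 1 (h s hs)) hc

lemma face_mem (s : List V) :
    (face s : List V →₀ R) ∈ supported R R {t | t.length + 1 = s.length ∧ t.Sublist s} := by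
  induction s with
  | nil => simp [face]
  | cons v s ih =>
    refine Submodule.sub_mem _ (single_mem_supported R 1 (by simp)) (cone_mem_supported ?_ ih)
    rintro t ⟨h1, h2⟩
    exact ⟨by simp [h1], h2.cons_cons v⟩

/-- Linear maps out of the chain complex are determined by their values on tuples, inductively in
terms of the boundary. -/
lemma hom_ext_of_face {L L' : (List V →₀ R) →ₗ[R] M}
    (h : ∀ s, L (face s) = L' (face s) → L (single s 1) = L' (single s 1)) : L = L' := by
  have key : ∀ n, ∀ s : List V, s.length = n → L (single s 1) = L' (single s 1) := by
    intro n
    induction n with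
    | zero =>
      intro s hs
      obtain rfl := List.length_eq_zero_iff.1 hs
      exact h _ (by simp [face])
    | succ n ih =>
      intro s hs
      refine h _ (eq_of_supported (fun t ht => ih t ?_) (face_mem s))
      have := ht.1
      omega
  refine Finsupp.lhom_ext' fun s => LinearMap.ext_ring ?_
  exact key _ s rfl

/-- Approximations of `recHom`, correct on tuples of length less than the index. -/
noncomputable def recAux (step : List V → M → M) : ℕ → (List V →₀ R) →ₗ[R] M
  | 0 => 0
  | n + 1 => linearCombination R fun s => step s (recAux step n (face s))

lemma recAux_eq (step : List V → M → M) (n m : ℕ) (s : List V) (hn : s.length < n)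
    (hm : s.length < m) :
    recAux (R := R) step n (single s 1) = recAux (R := R) step m (single s 1) := by
  induction n generalizing m s with
  | zero => simp at hn
  | succ n ih =>
    obtain ⟨m, rfl⟩ : ∃ m', m = m' + 1 := ⟨m - 1, by omega⟩
    have : recAux (R := R) step n (face s) = recAux (R := R) step m (face s) := by
      refine eq_of_supported (fun t ht => ?_) (face_mem s)
      have h := ht.1
      exact ih m t (by omega) (by omega)
    simp [recAux, this]

/-- The linear map defined on tuples by recursion through the boundary. -/
noncomputable def recHom (step : List V → M → M) : (List V →₀ R) →ₗ[R] M :=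
  linearCombination R fun s => recAux (R := R) step (s.length + 1) (single s 1)

lemma recHom_single (step : List V → M → M) (s : List V) :
    recHom (R := R) step (single s 1) = step s (recHom (R := R) step (face s)) := by
  have : recHom (R := R) step (face s) = recAux (R := R) step s.length (face s) := by
    refine eq_of_supported (fun t ht => ?_) (face_mem s)
    have h := ht.1
    simp only [recHom, linearCombination_single, one_smul]
    exact recAux_eq step _ _ t (by omega) (by omega)
  rw [this]
  simp [recHom, recAux]

/-- The chain map replacing every tuple `s` by the cone with apex `b s` over the image of its
boundary. -/
noncomputable def subdiv (b : List V → W) : (List V →₀ R) →ₗ[R] (List W →₀ R) :=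
  recHom fun s x => if s = [] then single [] 1 else cone (b s) x

lemma subdiv_nil (b : List V → W) : subdiv (R := R) b (single [] 1) = single [] 1 := by
  rw [subdiv, recHom_single]; simp

lemma subdiv_cons (b : List V → W) {s : List V} (hs : s ≠ []) :
    subdiv (R := R) b (single s 1) = cone (b s) (subdiv b (face s)) := by
  rw [subdiv, recHom_single]; simp [hs]

lemma bd_subdiv (b : List V → W) (c : List V →₀ R) : bd (subdiv b c) = subdiv b (bd c) := by
  have : (bd ∘ₗ subdiv b : (List V →₀ R) →ₗ[R] _) = subdiv b ∘ₗ bd := by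
    refine hom_ext_of_face fun s h => ?_
    by_cases hs : s = []
    · subst hs; simp [subdiv_nil, face]
    · simp only [LinearMap.comp_apply, bd_single, bd_face, map_zero] at h ⊢
      rw [subdiv_cons b hs, bd_cone, h]; simp
  exact LinearMap.congr_fun this c

lemma map_subdiv (b : List V → W) (f : V → V) (g : W → W) (h : ∀ s, s ≠ [] → b (s.map f) = g (b s))
    (c : List V →₀ R) : map g (subdiv b c) = subdiv b (map f c) := by
  have : (map g ∘ₗ subdiv b : (List V →₀ R) →ₗ[R] _) = subdiv b ∘ₗ map f := by
    refine hom_ext_of_face fun s ih => ?_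
    by_cases hs : s = []
    · subst hs; simp [subdiv_nil]
    · simp only [LinearMap.comp_apply, map_face] at ih ⊢
      rw [subdiv_cons b hs, map_cone, ih, map_single, subdiv_cons b (by simpa using hs), h s hs]
  exact LinearMap.congr_fun this c

lemma subdiv_mem (b : List V → W) (P : List V → List W → Prop) (h0 : P [] [])
    (h : ∀ s t, s ≠ [] → (∃ s', s'.length + 1 = s.length ∧ s'.Sublist s ∧ P s' t) → P s (b s :: t))
    (s : List V) : subdiv (R := R) b (single s 1) ∈ supported R R {t | P s t} := by
  induction hn : s.length generalizing s with
  | zero =>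
    obtain rfl := List.length_eq_zero_iff.1 hn
    rw [subdiv_nil]
    exact single_mem_supported R 1 h0
  | succ n ih =>
    have hs : s ≠ [] := by rintro rfl; simp at hn
    rw [subdiv_cons b hs]
    refine cone_mem_supported (S := {t | ∃ s', s'.length + 1 = s.length ∧ s'.Sublist s ∧ P s' t})
      (fun t (ht : ∃ s', _) => h s t hs ht) ?_
    refine mem_of_supported _ _ (fun s' hs' => ?_) (face_mem s)
    have hsub : {t | P s' t} ⊆ {t | ∃ s', s'.length + 1 = s.length ∧ s'.Sublist s ∧ P s' t} :=
      fun t ht => ⟨s', hs'.1, hs'.2, ht⟩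
    exact supported_mono hsub (ih s' (by have := hs'.1; omega))

/-- The cone homotopy between two augmentation-preserving chain maps. -/
noncomputable def homotopy (A B : (List V →₀ R) →ₗ[R] (List W →₀ R)) (b : List V → W) :
    (List V →₀ R) →ₗ[R] (List W →₀ R) :=
  recHom fun s x => if s = [] then 0 else cone (b s) (A (single s 1) - B (single s 1) - x)

variable {A B : (List V →₀ R) →ₗ[R] (List W →₀ R)}

lemma homotopy_nil (b : List V → W) : homotopy A B b (single [] 1) = 0 := by
  rw [homotopy, recHom_single]; simp

lemma homotopy_cons (b : List V → W) {s : List V} (hs : s ≠ []) : homotopy A B b (single s 1) =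
    cone (b s) (A (single s 1) - B (single s 1) - homotopy A B b (face s)) := by
  rw [homotopy, recHom_single]; simp [hs]

lemma bd_homotopy (hA : ∀ c, bd (A c) = A (bd c)) (hB : ∀ c, bd (B c) = B (bd c))
    (h0 : A (single [] 1) = B (single [] 1)) (b : List V → W) (c : List V →₀ R) :
    bd (homotopy A B b c) + homotopy A B b (bd c) = A c - B c := by
  have : bd ∘ₗ homotopy A B b + homotopy A B b ∘ₗ bd = A - B := by
    refine hom_ext_of_face fun s h => ?_
    by_cases hs : s = []
    · subst hs; simp [homotopy_nil, face, h0]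
    · simp only [LinearMap.add_apply, LinearMap.comp_apply, LinearMap.sub_apply, bd_face, map_zero,
        add_zero, bd_single] at h ⊢
      rw [homotopy_cons b hs, bd_cone]
      simp only [map_sub, hA, hB, h, bd_single]
      simp
  exact LinearMap.congr_fun this c

lemma map_homotopy (b : List V → W) (f : V → V) (g : W → W)
    (hA : ∀ c, map g (A c) = A (map f c)) (hB : ∀ c, map g (B c) = B (map f c))
    (h : ∀ s, s ≠ [] → b (s.map f) = g (b s)) (c : List V →₀ R) :
    map g (homotopy A B b c) = homotopy A B b (map f c) := by
  have : map g ∘ₗ homotopy A B b = homotopy A B b ∘ₗ map f := by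
    refine hom_ext_of_face fun s ih => ?_
    by_cases hs : s = []
    · subst hs; simp [homotopy_nil]
    · simp only [LinearMap.comp_apply, map_face] at ih ⊢
      rw [homotopy_cons b hs, map_cone, map_single, homotopy_cons b (by simpa using hs), h s hs]
      simp [hA, hB, ih]
  exact LinearMap.congr_fun this c

end Basic

section Cochains

variable {F : Type*} [CommRing F] {V W ι : Type*}

/-- Evaluation of a cochain on chains. -/
noncomputable def ev (f : List V → F) : (List V →₀ F) →ₗ[F] F :=
  linearCombination F f

@[simp] lemma ev_single (f : List V → F) (s : List V) : ev f (single s 1) = f s := by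
  simp [ev]

lemma ev_cone (f : List V → F) (v : V) (c : List V →₀ F) :
    ev f (cone v c) = ev (fun s => f (v :: s)) c := by
  have : ev f ∘ₗ cone v = ev fun s => f (v :: s) := by
    refine Finsupp.lhom_ext' fun s => LinearMap.ext_ring ?_
    simp
  exact LinearMap.congr_fun this c

lemma ev_map (f : List W → F) (a : V → W) (c : List V →₀ F) :
    ev f (map a c) = ev (fun s => f (s.map a)) c := by
  have : ev f ∘ₗ map a = ev fun s => f (s.map a) := by
    refine Finsupp.lhom_ext' fun s => LinearMap.ext_ring ?_
    simp
  exact LinearMap.congr_fun this c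

lemma ev_face_cons (f : List V → F) (v : V) (s : List V) :
    ev f (face (v :: s)) = f s - ev (fun t => f (v :: t)) (face s) := by
  simp [face, ev_cone]

lemma ev_mul_left (a : F) (f : List V → F) (c : List V →₀ F) :
    ev (fun s => a * f s) c = a * ev f c := by
  have : ev (fun s => a * f s) = a • ev f := by
    refine Finsupp.lhom_ext' fun s => LinearMap.ext_ring ?_
    simp
  exact LinearMap.congr_fun this c

/-- Cup product with a cochain of degree zero on the left. -/
def cup0 (e : V → F) (f : List V → F) : List V → F
  | [] => 0
  | v :: s => e v * f (v :: s)

/-- Cup product with a cochain of degree one on the left. -/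
def cup1 (r : V → V → F) (f : List V → F) : List V → F
  | [] => 0
  | v :: s => cup0 (r v) f s

/-- Cup product with a cochain of degree two on the left. -/
def cup2 (c : V → V → V → F) (f : List V → F) : List V → F
  | [] => 0
  | v :: s => cup1 (c v) f s

lemma ev_cup0_face {f : List V → F} (hf : ∀ s, ev f (face s) = 0) (h0 : f [] = 0) (e : V → F)
    (s : List V) : ev (cup0 e f) (face s) = cup1 (fun a b => e b - e a) f s := by
  rcases s with _ | ⟨v, s⟩
  · simp [face, cup1]
  · have h := hf (v :: s)
    rw [ev_face_cons, sub_eq_zero] at h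
    rw [ev_face_cons]
    simp only [cup0, ev_mul_left, ← h]
    rcases s with _ | ⟨w, s⟩ <;> simp [cup0, cup1, h0, sub_mul]

lemma ev_cup1_face {f : List V → F} (hf : ∀ s, ev f (face s) = 0) (h0 : f [] = 0)
    (r : V → V → F) (s : List V) :
    ev (cup1 r f) (face s) = cup2 (fun a b c => r b c - r a c + r a b) f s := by
  rcases s with _ | ⟨v, s⟩
  · simp [face, cup2]
  · rw [ev_face_cons]
    simp only [cup1, ev_cup0_face hf h0]
    rcases s with _ | ⟨w, _ | ⟨x, s⟩⟩ <;> simp [cup0, cup1, cup2]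
    ring

lemma ev_cup2_face {f : List V → F} (hf : ∀ s, ev f (face s) = 0) (h0 : f [] = 0)
    {c : V → V → V → F} (hc : ∀ v w x y, c w x y - c v x y + c v w y - c v w x = 0)
    (s : List V) : ev (cup2 c f) (face s) = 0 := by
  rcases s with _ | ⟨v, s⟩
  · simp [face]
  · rw [ev_face_cons]
    simp only [cup2, ev_cup1_face hf h0]
    rcases s with _ | ⟨w, _ | ⟨x, _ | ⟨y, s⟩⟩⟩ <;> simp [cup0, cup1]
    linear_combination f (y :: s) * hc v w x y

lemma cup2_map {c : W → W → W → F} {f : List W → F} (a : V → W) (s : List V) :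
    cup2 c f (s.map a) =
      cup2 (fun x y z => c (a x) (a y) (a z)) (fun t => f (t.map a)) s := by
  rcases s with _ | ⟨v, _ | ⟨w, _ | ⟨x, s⟩⟩⟩ <;> simp [cup0, cup1, cup2]

/-- The iterated cup product of a list of cochains of degree two. -/
def cupProd (c : ι → V → V → V → F) : List ι → List V → F
  | [] => fun s => if s.length = 1 then 1 else 0
  | i :: l => cup2 (c i) (cupProd c l)

lemma cupProd_nil_right (c : ι → V → V → V → F) (l : List ι) : cupProd c l [] = 0 := by
  cases l <;> simp [cupProd, cup2]

lemma ev_cupProd_face {c : ι → V → V → V → F}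
    (hc : ∀ i v w x y, c i w x y - c i v x y + c i v w y - c i v w x = 0) (l : List ι)
    (s : List V) : ev (cupProd c l) (face s) = 0 := by
  induction l generalizing s with
  | nil =>
    rcases s with _ | ⟨v, _ | ⟨w, _ | ⟨x, s⟩⟩⟩
    · simp [face]
    · simp [face, cupProd]
    · simp [face, cupProd]
    · have : ev (fun _ : List V => (0 : F)) = 0 := by ext; simp [ev]
      simp [ev_face_cons, cupProd, this]
  | cons i l ih => exact ev_cup2_face ih (cupProd_nil_right c l) (hc i) s

lemma cupProd_map (c : ι → W → W → W → F) (a : V → W) (l : List ι) (s : List V) :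
    cupProd c l (s.map a) = cupProd (fun i x y z => c i (a x) (a y) (a z)) l s := by
  induction l generalizing s with
  | nil => simp [cupProd]
  | cons i l ih => simp only [cupProd, cup2_map, ih]

lemma of_cupProd_ne_zero (c : ι → V → V → V → F) (l : List ι) (s : List V)
    (h : cupProd c l s ≠ 0) : s.length = 2 * l.length + 1 ∧
      ∀ i ∈ l, ∃ x ∈ s, ∃ y ∈ s, ∃ z ∈ s, c i x y z ≠ 0 := by
  induction l generalizing s with
  | nil =>
    have : s.length = 1 := by
      by_contra hs
      simp [cupProd, hs] at h
    simp [this]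
  | cons i l ih =>
    rcases s with _ | ⟨v, _ | ⟨w, _ | ⟨x, s⟩⟩⟩
    · simp [cupProd, cup2] at h
    · simp [cupProd, cup2, cup1] at h
    · simp [cupProd, cup2, cup1, cup0] at h
    · simp only [cupProd, cup2, cup1, cup0] at h
      obtain ⟨h1, h2⟩ := ih _ (right_ne_zero_of_mul h)
      refine ⟨by simp at h1 ⊢; omega, fun j hj => ?_⟩
      rcases List.mem_cons.1 hj with rfl | hj
      · exact ⟨v, by simp, w, by simp, x, by simp, left_ne_zero_of_mul h⟩
      · obtain ⟨a, ha, b, hb, d, hd, hne⟩ := h2 j hj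
        have hsub : ∀ u ∈ x :: s, u ∈ v :: w :: x :: s := fun u hu => by
          simp only [List.mem_cons] at hu ⊢; tauto
        exact ⟨a, hsub a ha, b, hsub b hb, d, hsub d hd, hne⟩

end Cochains

section Group

variable {p : ℕ} [NeZero p] {G ι : Type*} [AddCommGroup G]

/-- Translation of chains on a group. -/
noncomputable abbrev tr (p : ℕ) {G : Type*} [AddCommGroup G] (g : G) :
    (List G →₀ ZMod p) →ₗ[ZMod p] (List G →₀ ZMod p) :=
  map (g + ·)

omit [NeZero p] in
lemma tr_tr (g h : G) (c : List G →₀ ZMod p) : tr p g (tr p h c) = tr p (g + h) c := by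
  rw [tr, tr, map_map]
  congr 2
  ext x
  simp [add_assoc]

/-- Cup product with the coboundary of `r` is injective on equivariant cohomology, when `r` is
invariant under the kernel of a split character `χ` to `ZMod p` and changes under translation by
the generator of the complement by the coboundary of a function `u` of norm one. -/
lemma exists_primitive_of_cup2 (χ : G →+ ZMod p) (θ : ZMod p →+ G) (hθ : ∀ a, χ (θ a) = a)
    (r : G → G → ZMod p) (u : G → ZMod p)
    (hr : ∀ g h, r (θ 1 + g) (θ 1 + h) - r g h = u h - u g)
    (hrK : ∀ κ, χ κ = 0 → ∀ g h, r (κ + g) (κ + h) = r g h)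
    (huK : ∀ κ, χ κ = 0 → ∀ g, u (κ + g) = u g)
    (huN : ∀ g, ∑ a : ZMod p, u (θ a + g) = 1)
    (ψ : List G → ZMod p) (hψG : ∀ g s, ψ (s.map (g + ·)) = ψ s)
    (hψ : ∀ s, ev ψ (face s) = 0) (hψ0 : ψ [] = 0)
    (e : (List G →₀ ZMod p) →ₗ[ZMod p] ZMod p) (heG : ∀ g c, e (tr p g c) = e c)
    (he : ∀ s, cup2 (fun a b c => r b c - r a c + r a b) ψ s = e (face s)) :
    ∃ e' : (List G →₀ ZMod p) →ₗ[ZMod p] ZMod p, (∀ g c, e' (tr p g c) = e' c) ∧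
      e' (single [] 1) = 0 ∧ ∀ s, ψ s = e' (face s) := by
  set γ := θ 1
  let π : G → G := fun g => g - θ (χ g)
  have hπK : ∀ κ, χ κ = 0 → ∀ g, π (κ + g) = κ + π g := fun κ hκ g => by
    simp [π, hκ, add_sub_assoc]
  have hπγ : ∀ a g, π (θ a + g) = π g := fun a g => by simp [π, hθ]
  let D : (List G →₀ ZMod p) →ₗ[ZMod p] (List G →₀ ZMod p) :=
    homotopy LinearMap.id (map π) (fun s => s.headD 0)
  have hD : ∀ c, bd (D c) + D (bd c) = c - map π c :=
    bd_homotopy (by simp) (fun c => (map_bd π c).symm) (by simp) _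
  have hDK : ∀ κ, χ κ = 0 → ∀ c, tr p κ (D c) = D (tr p κ c) := fun κ hκ c => by
    refine map_homotopy _ _ _ (by simp) (fun c => ?_) (fun s hs => ?_) c
    · rw [map_map, map_map]
      congr 2
      ext g
      simp [hπK κ hκ]
    · obtain ⟨v, s, rfl⟩ := List.exists_cons_of_ne_nil hs
      simp
  -- a `ker χ`-invariant cocycle differs from a `G`-invariant one by a coboundary
  have hsplit : ∀ y : (List G →₀ ZMod p) →ₗ[ZMod p] ZMod p, (∀ c, y (bd c) = 0) →
      ∀ c, y c = y (map π c) + y (D (bd c)) := fun y hy c => by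
    have := congrArg y (hD c)
    simp only [map_add, map_sub, hy] at this
    linear_combination -this
  have hπtr : ∀ a c, map π (tr p (θ a) c) = map (R := ZMod p) π c := fun a c => by
    rw [map_map]; congr 2; ext g; simp [hπγ]
  let φ := ev (cup0 u ψ)
  let ρ := ev (cup1 r ψ)
  have hφbd : ∀ c, φ (bd c) = ρ (tr p γ c) - ρ c := fun c => by
    have : φ ∘ₗ bd = ρ ∘ₗ tr p γ - ρ := by
      refine Finsupp.lhom_ext' fun s => LinearMap.ext_ring ?_
      simp only [LinearMap.comp_apply, LinearMap.sub_apply, lsingle_apply, bd_single, φ, ρ,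
        ev_cup0_face hψ hψ0, map_single, ev_single]
      rcases s with _ | ⟨v, _ | ⟨w, s⟩⟩ <;> simp [cup1, cup0]
      have := hψG γ (w :: s)
      simp only [List.map_cons] at this
      rw [this, ← hr]; ring
    exact LinearMap.congr_fun this c
  have hρK : ∀ κ, χ κ = 0 → ∀ c, ρ (tr p κ c) = ρ c := fun κ hκ c => by
    have : ρ ∘ₗ tr p κ = ρ := by
      refine Finsupp.lhom_ext' fun s => LinearMap.ext_ring ?_
      simp only [LinearMap.comp_apply, lsingle_apply, ρ, map_single, ev_single]
      rcases s with _ | ⟨v, _ | ⟨w, s⟩⟩ <;> simp [cup1, cup0]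
      have := hψG κ (w :: s)
      simp only [List.map_cons] at this
      rw [this, hrK κ hκ]
    exact LinearMap.congr_fun this c
  have hφK : ∀ κ, χ κ = 0 → ∀ c, φ (tr p κ c) = φ c := fun κ hκ c => by
    have : φ ∘ₗ tr p κ = φ := by
      refine Finsupp.lhom_ext' fun s => LinearMap.ext_ring ?_
      simp only [LinearMap.comp_apply, lsingle_apply, φ, map_single, ev_single]
      rcases s with _ | ⟨v, s⟩ <;> simp [cup0]
      have := hψG κ (v :: s)
      simp only [List.map_cons] at this
      rw [this, huK κ hκ]
    exact LinearMap.congr_fun this c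
  have hφN : ∀ c, ∑ a : ZMod p, φ (tr p (θ a) c) = ev ψ c := fun c => by
    have : ∑ a : ZMod p, φ ∘ₗ tr p (θ a) = ev ψ := by
      refine Finsupp.lhom_ext' fun s => LinearMap.ext_ring ?_
      simp only [LinearMap.comp_apply, lsingle_apply, φ, LinearMap.sum_apply, map_single, ev_single]
      rcases s with _ | ⟨v, s⟩
      · simp [cup0, hψ0]
      · have := fun a => hψG (θ a) (v :: s)
        simp only [List.map_cons] at this
        simp only [List.map_cons, cup0, this, ← Finset.sum_mul, huN, one_mul]
    simpa using LinearMap.congr_fun this c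
  let y := ρ - e
  have hybd : ∀ c, y (bd c) = 0 := fun c => by
    have : y ∘ₗ bd = 0 := by
      refine Finsupp.lhom_ext' fun s => LinearMap.ext_ring ?_
      simp [y, ρ, ev_cup1_face hψ hψ0, he]
    exact LinearMap.congr_fun this c
  have hyK : ∀ κ, χ κ = 0 → ∀ c, y (tr p κ c) = y c := fun κ hκ c => by
    simp only [y, LinearMap.sub_apply, hρK κ hκ, heG]
  let w := y ∘ₗ D
  have hwK : ∀ κ, χ κ = 0 → ∀ c, w (tr p κ c) = w c := fun κ hκ c => by
    simp only [w, LinearMap.comp_apply, ← hDK κ hκ, hyK κ hκ]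
  let φ' := φ - (w ∘ₗ tr p γ - w)
  have hφ'bd : ∀ c, φ' (bd c) = 0 := fun c => by
    have h1 := hsplit y hybd (tr p γ c)
    have h2 := hsplit y hybd c
    have h3 : y (tr p γ c) - y c = φ (bd c) := by
      rw [hφbd]; simp only [y, LinearMap.sub_apply, heG]; ring
    rw [hπtr] at h1
    simp only [φ', w, LinearMap.sub_apply, LinearMap.comp_apply, ← h3, tr, map_bd] at h1 ⊢
    linear_combination h1 - h2
  have hφ'K : ∀ κ, χ κ = 0 → ∀ c, φ' (tr p κ c) = φ' c := fun κ hκ c => by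
    simp only [φ', LinearMap.sub_apply, LinearMap.comp_apply, hφK κ hκ, hwK κ hκ]
    rw [tr_tr, add_comm, ← tr_tr, hwK κ hκ]
  have hφ'N : ∀ c, ∑ a : ZMod p, φ' (tr p (θ a) c) = ev ψ c := fun c => by
    simp only [φ', LinearMap.sub_apply, LinearMap.comp_apply, Finset.sum_sub_distrib, hφN, tr_tr]
    have : ∑ a : ZMod p, w (tr p (γ + θ a) c) = ∑ a : ZMod p, w (tr p (θ a) c) :=
      Fintype.sum_equiv (Equiv.addLeft 1) _ _ fun a => by simp [γ]
    rw [this]; ring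
  refine ⟨∑ a : ZMod p, φ' ∘ₗ D ∘ₗ tr p (θ a), fun g c => ?_, ?_, fun s => ?_⟩
  · simp only [LinearMap.sum_apply, LinearMap.comp_apply, tr_tr]
    refine Fintype.sum_equiv (Equiv.addRight (χ g)) _ _ fun a => ?_
    have h1 : θ a + g = (g - θ (χ g)) + θ (a + χ g) := by rw [map_add]; abel
    have h2 : χ (g - θ (χ g)) = 0 := by simp [hθ]
    rw [h1, ← tr_tr, ← hDK _ h2, hφ'K _ h2]
    rfl
  · simp [D, homotopy_nil]
  · have h1 := hφ'N (single s 1)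
    rw [ev_single] at h1
    rw [← h1]
    simp only [LinearMap.sum_apply, LinearMap.comp_apply]
    have h2 : ∀ a, φ' (tr p (θ a) (single s 1)) =
        φ' (map π (single s 1)) + φ' (D (tr p (θ a) (face s))) := fun a => by
      rw [hsplit φ' hφ'bd, hπtr, tr, ← map_bd, bd_single]
    simp only [h2, Finset.sum_add_distrib, Finset.sum_const, Finset.card_univ, ZMod.card]
    simp

lemma val_add_one_eq (x : ZMod p) :
    ((x + 1).val : ℤ) = x.val + 1 - p * (if x = -1 then 1 else 0) := by
  obtain ⟨n, rfl⟩ : ∃ n, p = n + 1 := ⟨p - 1, by have := NeZero.ne p; omega⟩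
  have hv := ZMod.val_neg_one n
  by_cases hx : x = -1
  · subst hx
    simp [hv]
  · have h1 : x.val ≠ n := fun h => hx (ZMod.val_injective _ (h.trans hv.symm))
    have h2 := ZMod.val_lt x
    have h3 := ZMod.val_add x 1
    rw [ZMod.val_one_eq_one_mod, Nat.mod_eq_of_lt (a := 1) (by omega),
      Nat.mod_eq_of_lt (by omega)] at h3
    simp [hx, h3]

/-- The carry cocycle of a split character, multiplied with a cocycle which is no coboundary of an
equivariant cochain, gives again such a cocycle. -/
lemma cupProd_not_coboundary [Nontrivial (ZMod p)] (χ : ι → G →+ ZMod p) (θ : ι → ZMod p →+ G)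
    (hθ : ∀ i a, χ i (θ i a) = a) (m : ZMod p → ℤ) (c : ι → G → G → G → ℤ)
    (hc : ∀ i x y z, (c i x y z : ℝ) = (((χ i z - χ i y).val : ℝ) / p + m (χ i z - χ i y))
      - (((χ i z - χ i x).val : ℝ) / p + m (χ i z - χ i x))
      + (((χ i y - χ i x).val : ℝ) / p + m (χ i y - χ i x))) (l : List ι)
    (e : (List G →₀ ZMod p) →ₗ[ZMod p] ZMod p) (heG : ∀ g c, e (tr p g c) = e c)
    (he0 : e (single [] 1) = 0) :
    ¬ ∀ s, cupProd (fun i x y z => (c i x y z : ZMod p)) l s = e (face s) := by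
  induction l generalizing e with
  | nil =>
    intro h
    have := h [0]
    simp [cupProd, face, he0] at this
  | cons i l ih =>
    intro h
    have hp : (p : ℝ) ≠ 0 := Nat.cast_ne_zero.2 (NeZero.ne p)
    have hdiv : ∀ a b : ZMod p, ∃ k : ℤ, ((b - a).val : ℤ) - b.val + a.val = p * k := fun a b => by
      have : (((b - a).val - b.val + a.val : ℤ) : ZMod p) = 0 := by simp
      exact (ZMod.intCast_zmod_eq_zero_iff_dvd _ _).1 this
    choose k hk using hdiv
    let R : G → G → ℤ := fun x y => m (χ i y - χ i x) + k (χ i x) (χ i y)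
    have hkR : ∀ a b : ZMod p, (((b - a).val : ℝ)) = b.val - a.val + p * k a b := fun a b => by
      have := hk a b
      have h2 : (((b - a).val : ℤ) : ℝ) - ((b.val : ℤ) : ℝ) + ((a.val : ℤ) : ℝ) = p * k a b := by
        exact_mod_cast this
      push_cast at h2
      linear_combination h2
    have hcR : ∀ x y z, c i x y z = R y z - R x z + R x y := fun x y z => by
      have h1 := hc i x y z
      rw [hkR, hkR, hkR] at h1
      have : (c i x y z : ℝ) = ((R y z - R x z + R x y : ℤ) : ℝ) := by
        rw [h1]
        simp only [R]
        push_cast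
        field_simp
        ring
      exact_mod_cast this
    have hinv : ∀ j g x y z, c j (g + x) (g + y) (g + z) = c j x y z := fun j g x y z => by
      have : (c j (g + x) (g + y) (g + z) : ℝ) = c j x y z := by
        rw [hc, hc]; simp
      exact_mod_cast this
    have hcoc : ∀ j v w x y, c j w x y - c j v x y + c j v w y - c j v w x = 0 :=
      fun j v w x y => by
        have : (c j w x y - c j v x y + c j v w y - c j v w x : ℝ) = 0 := by
          simp only [hc]; ring
        exact_mod_cast this
    obtain ⟨e', h1, h2, h3⟩ := exists_primitive_of_cup2 (χ i) (θ i) (hθ i)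
      (fun x y => (R x y : ZMod p)) (fun x => if χ i x = -1 then 1 else 0)
      (fun g h => by
        have hv := val_add_one_eq (χ i g)
        have hw := val_add_one_eq (χ i h)
        have h1 := hk (1 + χ i g) (1 + χ i h)
        have h2 := hk (χ i g) (χ i h)
        rw [add_sub_add_left_eq_sub, add_comm 1, add_comm 1, hv, hw] at h1
        have h3 : (p : ℤ) * (k (χ i g + 1) (χ i h + 1)) = p * (k (χ i g) (χ i h) +
            ((if χ i h = -1 then 1 else 0) - if χ i g = -1 then 1 else 0)) := by
          linear_combination h2 - h1
        have h4 := mul_left_cancel₀ (by exact_mod_cast NeZero.ne p) h3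
        simp only [R, map_add, hθ, add_sub_add_left_eq_sub]
        rw [add_comm 1, add_comm 1, h4]
        push_cast
        ring)
      (fun κ hκ g h => by simp [R, hκ]) (fun κ hκ g => by simp [hκ])
      (fun g => by simp [hθ, ← eq_sub_iff_add_eq])
      (cupProd (fun i x y z => (c i x y z : ZMod p)) l)
      (fun g s => by simp [cupProd_map, hinv])
      (ev_cupProd_face (fun j v w x y => by
        exact_mod_cast congrArg (Int.cast : ℤ → ZMod p) (hcoc j v w x y)) l)
      (cupProd_nil_right _ l) e heG (fun s => by
        rw [← h s]
        simp [cupProd, hcR])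
    exact ih e' h1 h2 h3

end Group

section Barycentric

variable {R : Type*} [CommRing R] {G E : Type*} [Zero G] [NormedAddCommGroup E] [NormedSpace ℝ E]

/-- The apex used in barycentric subdivision: the label of the first vertex, and the barycenter. -/
noncomputable def apex (s : List (G × E)) : G × E :=
  ((s.map Prod.fst).headD 0, (s.length : ℝ)⁻¹ • (s.map Prod.snd).sum)

omit [NormedSpace ℝ E] in
lemma norm_sum_map_le {V : Type*} (f : V → E) (D : ℝ) (s : List V) (h : ∀ u ∈ s, ‖f u‖ ≤ D) :
    ‖(s.map f).sum‖ ≤ s.length * D := by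
  induction s with
  | nil => simp
  | cons v s ih =>
    simp only [List.map_cons, List.sum_cons, List.length_cons, Nat.cast_add, Nat.cast_one]
    have h1 := ih fun u hu => h u (by simp [hu])
    have h2 := h v (by simp)
    have h3 := norm_add_le (f v) (s.map f).sum
    linarith

omit [NormedSpace ℝ E] in
lemma norm_sum_map_le_of_eq_zero {V : Type*} (f : V → E) (D : ℝ) (s : List V)
    (h : ∀ u ∈ s, ‖f u‖ ≤ D) {v : V} (hv : v ∈ s) (h0 : f v = 0) :
    ‖(s.map f).sum‖ ≤ (s.length - 1) * D := by
  induction s with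
  | nil => simp at hv
  | cons w s ih =>
    simp only [List.map_cons, List.sum_cons, List.length_cons, Nat.cast_add, Nat.cast_one]
    rcases List.mem_cons.1 hv with rfl | hv
    · rw [h0, zero_add, add_sub_cancel_right]
      exact norm_sum_map_le f D s fun u hu => h u (by simp [hu])
    · have h1 := ih (fun u hu => h u (by simp [hu])) hv
      have h2 := h w (by simp)
      have h3 := norm_add_le (f w) (s.map f).sum
      linarith

lemma dist_apex_le {s : List (G × E)} {D : ℝ} (h : ∀ x ∈ s, ∀ y ∈ s, dist x.2 y.2 ≤ D)
    {v : G × E} (hv : v ∈ s) : dist (apex s).2 v.2 ≤ (1 - (s.length : ℝ)⁻¹) * D := by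
  have hpos : (0 : ℝ) < s.length := by exact_mod_cast List.length_pos_of_mem hv
  have hsum : ∀ t : List (G × E), (t.map fun u => u.2 - v.2).sum =
      (t.map Prod.snd).sum - (t.length : ℝ) • v.2 := fun t => by
    induction t with
    | nil => simp
    | cons w t ih =>
      simp only [List.map_cons, List.sum_cons, ih, List.length_cons, Nat.cast_add, Nat.cast_one]
      module
  have h1 : (apex s).2 - v.2 = (s.length : ℝ)⁻¹ • (s.map fun u => u.2 - v.2).sum := by
    rw [hsum, smul_sub, inv_smul_smul₀ hpos.ne']; rfl
  have h2 := norm_sum_map_le_of_eq_zero (fun u : G × E => u.2 - v.2) D s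
    (fun u hu => by rw [← dist_eq_norm]; exact h u hu v hv) hv (by simp)
  rw [dist_eq_norm, h1, norm_smul, norm_inv, Real.norm_of_nonneg hpos.le]
  calc (s.length : ℝ)⁻¹ * ‖(s.map fun u => u.2 - v.2).sum‖
      ≤ (s.length : ℝ)⁻¹ * ((s.length - 1) * D) := by gcongr
    _ = _ := by field_simp

lemma apex_mem {K : Set E} (hK : Convex ℝ K) {s : List (G × E)} (hs : s ≠ [])
    (h : ∀ v ∈ s, v.2 ∈ K) : (apex s).2 ∈ K := by
  have key : ∀ t : List (G × E), (∀ v ∈ t, v.2 ∈ K) → t ≠ [] →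
      ∃ x ∈ K, (t.map Prod.snd).sum = (t.length : ℝ) • x := fun t => by
    induction t with
    | nil => simp
    | cons v t ih =>
      intro ht _
      by_cases h0 : t = []
      · exact ⟨v.2, ht v (by simp), by simp [h0]⟩
      · obtain ⟨x, hx, hsum⟩ := ih (fun u hu => ht u (by simp [hu])) h0
        have hpos : (0 : ℝ) < t.length := by exact_mod_cast List.length_pos_iff.2 h0
        refine ⟨((1 : ℝ) / (t.length + 1)) • v.2 + ((t.length : ℝ) / (t.length + 1)) • x,
          hK (ht v (by simp)) hx (by positivity) (by positivity) (by field_simp; ring), ?_⟩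
        simp only [List.map_cons, List.sum_cons, hsum, List.length_cons, Nat.cast_add, Nat.cast_one]
        rw [smul_add, smul_smul, smul_smul, mul_div_cancel₀ _ (by positivity),
          mul_div_cancel₀ _ (by positivity), one_smul]
  obtain ⟨x, hx, hsum⟩ := key s h hs
  have hpos : (s.length : ℝ) ≠ 0 := by simpa using hs
  rw [apex, hsum, inv_smul_smul₀ hpos]
  exact hx

lemma subdiv_apex_mem (s : List (G × E)) :
    subdiv (R := R) apex (single s 1) ∈ supported R R {t | t.length = s.length ∧
      (∀ v ∈ t, v.2 ∈ convexHull ℝ {x | ∃ u ∈ s, u.2 = x}) ∧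
      ∀ D, (∀ x ∈ s, ∀ y ∈ s, dist x.2 y.2 ≤ D) →
        ∀ x ∈ t, ∀ y ∈ t, dist x.2 y.2 ≤ (1 - (s.length : ℝ)⁻¹) * D} := by
  refine subdiv_mem apex (fun s t => t.length = s.length ∧
      (∀ v ∈ t, v.2 ∈ convexHull ℝ {x | ∃ u ∈ s, u.2 = x}) ∧
      ∀ D, (∀ x ∈ s, ∀ y ∈ s, dist x.2 y.2 ≤ D) →
        ∀ x ∈ t, ∀ y ∈ t, dist x.2 y.2 ≤ (1 - (s.length : ℝ)⁻¹) * D) (by simp) ?_ s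
  rintro s t hs ⟨s', hlen, hsub, htlen, htK, htD⟩
  have hconv : ∀ v ∈ t, v.2 ∈ convexHull ℝ {x | ∃ u ∈ s, u.2 = x} := fun v hv =>
    convexHull_mono (by rintro x ⟨u, hu, rfl⟩; exact ⟨u, hsub.subset hu, rfl⟩) (htK v hv)
  refine ⟨by simp [htlen, hlen], ?_, fun D hD => ?_⟩
  · rintro v hv
    rcases List.mem_cons.1 hv with rfl | hv
    · exact apex_mem (convex_convexHull ℝ _) hs fun v hv => subset_convexHull ℝ _ ⟨v, hv, rfl⟩
    · exact hconv v hv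
  · obtain ⟨v₀, hv₀⟩ := List.exists_mem_of_ne_nil s hs
    have hD0 : 0 ≤ D := dist_nonneg.trans (hD v₀ hv₀ v₀ hv₀)
    have hslen : (s.length : ℝ) = s'.length + 1 := by exact_mod_cast hlen.symm
    have hfac : 0 ≤ 1 - (s.length : ℝ)⁻¹ := by
      rw [sub_nonneg]
      refine inv_le_one_of_one_le₀ ?_
      rw [hslen]
      linarith [Nat.cast_nonneg (α := ℝ) s'.length]
    have hapex : ∀ y ∈ t, dist (apex s).2 y.2 ≤ (1 - (s.length : ℝ)⁻¹) * D := fun y hy => by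
      have : convexHull ℝ {x | ∃ u ∈ s, u.2 = x} ⊆
          Metric.closedBall (apex s).2 ((1 - (s.length : ℝ)⁻¹) * D) := by
        refine convexHull_min ?_ (convex_closedBall _ _)
        rintro x ⟨u, hu, rfl⟩
        rw [Metric.mem_closedBall, dist_comm]
        exact dist_apex_le hD hu
      have := this (hconv y hy)
      rwa [Metric.mem_closedBall, dist_comm] at this
    intro x hx y hy
    rcases List.mem_cons.1 hx with rfl | hx <;> rcases List.mem_cons.1 hy with rfl | hy
    · simpa using mul_nonneg hfac hD0
    · exact hapex y hy
    · rw [dist_comm]; exact hapex x hx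
    · refine (htD D (fun x hx y hy => hD x (hsub.subset hx) y (hsub.subset hy)) x hx y hy).trans ?_
      have hpos : (0 : ℝ) < s'.length := by
        rw [← htlen]; exact_mod_cast List.length_pos_of_mem hx
      rw [hslen]
      gcongr
      linarith

/-- Iterated barycentric subdivision makes tuples in a convex set small. -/
lemma iterate_subdiv_apex_mem {K : Set E} (hK : Convex ℝ K) {D : ℝ} {s : List (G × E)}
    (hsK : ∀ v ∈ s, v.2 ∈ K) (hsD : ∀ x ∈ s, ∀ y ∈ s, dist x.2 y.2 ≤ D) (j : ℕ) :
    (subdiv (R := R) apex)^[j] (single s 1) ∈ supported R R {t | t.length = s.length ∧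
      (∀ v ∈ t, v.2 ∈ K) ∧
      ∀ x ∈ t, ∀ y ∈ t, dist x.2 y.2 ≤ (1 - (s.length : ℝ)⁻¹) ^ j * D} := by
  induction j with
  | zero => exact single_mem_supported R 1 ⟨rfl, hsK, by simpa using hsD⟩
  | succ j ih =>
    rw [Function.iterate_succ_apply']
    refine mem_of_supported _ _ ?_ ih
    rintro t ⟨htlen, htK, htD⟩
    refine supported_mono (s := {u | u.length = t.length ∧
      (∀ v ∈ u, v.2 ∈ convexHull ℝ {x | ∃ w ∈ t, w.2 = x}) ∧
      ∀ D, (∀ x ∈ t, ∀ y ∈ t, dist x.2 y.2 ≤ D) →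
        ∀ x ∈ u, ∀ y ∈ u, dist x.2 y.2 ≤ (1 - (t.length : ℝ)⁻¹) * D}) ?_ (subdiv_apex_mem t)
    rintro u ⟨hulen, huK, huD⟩
    refine ⟨hulen.trans htlen, fun v hv => ?_, fun x hx y hy => ?_⟩
    · refine convexHull_min ?_ hK (huK v hv)
      rintro x ⟨w, hw, rfl⟩
      exact htK w hw
    · have := huD _ htD x hx y hy
      rwa [htlen, ← mul_assoc, ← pow_succ'] at this

end Barycentric

section Join

variable {N : ℕ} {G : Type*} [AddCommGroup G] [Fintype G] [DecidableEq G]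

/-- The translation action on the space containing the `N`-fold join of `G`. -/
def shift (g : G) (x : Fin N × G → ℝ) : Fin N × G → ℝ := fun v => x (v.1, v.2 - g)

/-- The vertex `g` of the factor `m` of the join. -/
def vertex (m : ℕ) (g : G) : Fin N × G → ℝ := fun v => if v.1.val = m ∧ v.2 = g then 1 else 0

/-- The simplex of the join spanned by one vertex of each factor. -/
def joinFace (h : Fin N → G) : Set (Fin N × G → ℝ) :=
  {x | (∀ v, 0 ≤ x v) ∧ ∑ v, x v = 1 ∧ ∀ i a, x (i, a) ≠ 0 → a = h i}

omit [Fintype G] in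
lemma shift_vertex (m : ℕ) (h g : G) :
    shift h (vertex m g : Fin N × G → ℝ) = vertex m (h + g) := by
  ext v
  simp [shift, vertex, sub_eq_iff_eq_add, add_comm]

omit [AddCommGroup G] [DecidableEq G] in
lemma convex_joinFace (h : Fin N → G) : Convex ℝ (joinFace h) := by
  rintro x ⟨hx0, hx1, hx2⟩ y ⟨hy0, hy1, hy2⟩ a b ha hb hab
  refine ⟨fun v => ?_, ?_, fun i c hne => ?_⟩
  · have := hx0 v; have := hy0 v
    simp only [Pi.add_apply, Pi.smul_apply, smul_eq_mul]
    positivity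
  · simp [Finset.sum_add_distrib, ← Finset.mul_sum, hx1, hy1, hab]
  · by_contra hc
    have h1 : x (i, c) = 0 := by_contra fun h' => hc (hx2 i c h')
    have h2 : y (i, c) = 0 := by_contra fun h' => hc (hy2 i c h')
    simp [h1, h2] at hne

omit [AddCommGroup G] [DecidableEq G] in
lemma isCompact_joinFace (h : Fin N → G) : IsCompact (joinFace h) := by
  refine (isCompact_stdSimplex ℝ (Fin N × G)).of_isClosed_subset ?_ fun x hx => ⟨hx.1, hx.2.1⟩
  have : joinFace h = (⋂ v, {x : Fin N × G → ℝ | 0 ≤ x v}) ∩ {x | ∑ v, x v = 1} ∩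
      ⋂ v : Fin N × G, {x | v.2 ≠ h v.1 → x v = 0} := by
    ext x
    simp only [joinFace, Set.mem_ofPred_eq, Set.mem_inter_iff, Set.mem_iInter, Prod.forall, and_assoc]
    refine and_congr_right fun _ => and_congr_right fun _ => forall₂_congr fun i a => ?_
    rw [← not_imp_not, not_not]
  rw [this]
  refine ((isClosed_iInter fun v => isClosed_le continuous_const (continuous_apply v)).inter
    (isClosed_eq (by fun_prop) continuous_const)).inter (isClosed_iInter fun v => ?_)
  by_cases hv : v.2 = h v.1
  · simp [hv]
  · simpa [hv] using isClosed_eq (continuous_apply v) continuous_const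

omit [AddCommGroup G] in
lemma vertex_mem_joinFace (h : Fin N → G) (i : Fin N) : vertex i (h i) ∈ joinFace h := by
  refine ⟨fun v => by unfold vertex; positivity, ?_, fun j a hne => ?_⟩
  · rw [Finset.sum_eq_single (i, h i)]
    · simp [vertex]
    · rintro ⟨j, a⟩ _ hne
      simp only [vertex, ite_eq_right_iff, one_ne_zero, imp_false]
      rintro ⟨h1, h2⟩
      exact hne (by simp [Fin.ext h1, h2])
    · simp
  · simp only [vertex, ne_eq, ite_eq_right_iff, one_ne_zero, imp_false, not_not] at hne
    obtain ⟨h1, rfl⟩ := hne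
    rw [Fin.ext h1]

/-- The apex used to map tuples of group elements to simplices of the join. -/
def joinApex (s : List G) : G × (Fin N × G → ℝ) :=
  (s.headD 0, vertex (s.length - 1) (s.headD 0))

omit [Fintype G] in
lemma subdiv_joinApex_mem {R : Type*} [CommRing R] (s : List G) :
    subdiv (R := R) (joinApex (N := N)) (single s 1) ∈ supported R R {t | t.length = s.length ∧
      (s.length ≤ N → ∃ h : Fin N → G, ∀ v ∈ t, ∃ i : Fin N, i.val < s.length ∧
        v.2 = vertex i (h i))} := by
  refine subdiv_mem _ (fun (s : List G) (t : List (G × (Fin N × G → ℝ))) => t.length = s.length ∧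
      (s.length ≤ N → ∃ h : Fin N → G, ∀ v ∈ t, ∃ i : Fin N, i.val < s.length ∧
        v.2 = vertex i (h i))) (by simp) ?_ s
  rintro s t hs ⟨s', hlen, -, htlen, ht⟩
  refine ⟨by simp [htlen, hlen], fun hN => ?_⟩
  obtain ⟨h, hh⟩ := ht (by omega)
  let m : Fin N := ⟨s.length - 1, by omega⟩
  refine ⟨Function.update h m (s.headD 0), fun v hv => ?_⟩
  rcases List.mem_cons.1 hv with rfl | hv
  · exact ⟨m, by simp only [m]; omega, by simp [joinApex, m]⟩
  · obtain ⟨i, hi, hvi⟩ := hh v hv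
    refine ⟨i, by omega, ?_⟩
    have : i ≠ m := fun h => by
      have := congrArg Fin.val h
      simp only [m] at this
      omega
    rw [Function.update_of_ne this, hvi]

/-- An equivariant map from the join of `2 * n + 1` copies of `G` to a sum of `n` split characters
has a zero. -/
theorem exists_common_zero {p : ℕ} [Fact p.Prime] {ι : Type*} (χ : ι → G →+ ZMod p)
    (θ : ι → ZMod p →+ G) (hθ : ∀ i a, χ i (θ i a) = a) (l : List ι) (hN : N = 2 * l.length + 1)
    (F : ι → (Fin N × G → ℝ) → ℂ) (hF : ∀ i, Continuous (F i))
    (hFG : ∀ i g x, F i (shift g x) = ZMod.stdAddChar (χ i g) * F i x) :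
    ∃ h : Fin N → G, ∃ x ∈ joinFace h, ∀ i ∈ l, F i x = 0 := by
  by_contra! hcon
  set ω : AddChar (ZMod p) ℂ := ZMod.stdAddChar
  have hω : ∀ a, ω a ≠ 0 := fun a => by simp [ω, ZMod.stdAddChar_apply]
  let X : Set (Fin N × G → ℝ) := ⋃ h : Fin N → G, joinFace h
  have hX : IsCompact X := isCompact_iUnion isCompact_joinFace
  obtain ⟨δ, hδ, hδX⟩ : ∃ δ > 0, ∀ x ∈ X, ∃ i ∈ l, ∀ y ∈ Metric.ball x δ, ∀ z ∈ Metric.ball x δ,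
      ‖F i z - F i y‖ < ‖F i y‖ := by
    have hloc : ∀ x : X, ∃ U : Set (Fin N × G → ℝ), IsOpen U ∧ x.1 ∈ U ∧ ∃ i ∈ l,
        ∀ y ∈ U, ∀ z ∈ U, ‖F i z - F i y‖ < ‖F i y‖ := by
      rintro ⟨x, hx⟩
      obtain ⟨h, hxh⟩ := Set.mem_iUnion.1 hx
      obtain ⟨i, hi, hne⟩ := hcon h x hxh
      have hpos : 0 < ‖F i x‖ := norm_pos_iff.2 hne
      refine ⟨F i ⁻¹' Metric.ball (F i x) (‖F i x‖ / 4), Metric.isOpen_ball.preimage (hF i),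
        by simpa using hne, i, hi, fun y hy z hz => ?_⟩
      have hy' : dist (F i y) (F i x) < ‖F i x‖ / 4 := hy
      have hz' : dist (F i z) (F i x) < ‖F i x‖ / 4 := hz
      have h1 := dist_triangle_right (F i z) (F i y) (F i x)
      have h2 := norm_sub_norm_le (F i x) (F i y)
      rw [← dist_eq_norm, dist_comm] at h2
      rw [← dist_eq_norm]
      linarith
    choose U hUo hUx hU using hloc
    obtain ⟨δ, hδ, hb⟩ := lebesgue_number_lemma_of_metric hX hUo
      fun x hx => Set.mem_iUnion.2 ⟨⟨x, hx⟩, hUx ⟨x, hx⟩⟩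
    refine ⟨δ, hδ, fun x hx => ?_⟩
    obtain ⟨y, hyx⟩ := hb x hx
    obtain ⟨i, hi, h⟩ := hU y
    exact ⟨i, hi, fun y hy z hz => h y (hyx hy) z (hyx hz)⟩
  -- nowhere vanishing equivariant functions on `G × E`
  let V := G × (Fin N × G → ℝ)
  let act : G → V → V := fun g v => (g + v.1, shift g v.2)
  let F' : ι → V → ℂ := fun i v => if F i v.2 = 0 then ω (χ i v.1) else F i v.2
  have hF'0 : ∀ i v, F' i v ≠ 0 := fun i v => by
    by_cases h : F i v.2 = 0 <;> simp [F', h, hω]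
  have hF'G : ∀ i g v, F' i (act g v) = ω (χ i g) * F' i v := fun i g v => by
    by_cases h : F i v.2 = 0
    · simp [F', act, hFG, h, AddChar.map_add_eq_mul]
    · simp [F', act, hFG, h, hω, ω]
  let d : ι → V → V → ℝ := fun i u v => (F' i v / F' i u).arg / (2 * Real.pi)
  have hdG : ∀ i g u v, d i (act g u) (act g v) = d i u v := fun i g u v => by
    simp only [d, hF'G, mul_div_mul_left _ _ (hω _)]
  have hint : ∀ i u v w, ∃ c : ℤ, (c : ℝ) = d i v w - d i u w + d i u v := fun i u v w => by
    have h1 : F' i w / F' i u = (F' i w / F' i v) * (F' i v / F' i u) := by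
      have := hF'0 i v
      field_simp
    have h2 := Complex.arg_mul_coe_angle (div_ne_zero (hF'0 i w) (hF'0 i v))
      (div_ne_zero (hF'0 i v) (hF'0 i u))
    rw [← h1, ← Real.Angle.coe_add, eq_comm, Real.Angle.angle_eq_iff_two_pi_dvd_sub] at h2
    obtain ⟨k, hk⟩ := h2
    refine ⟨k, ?_⟩
    simp only [d]
    field_simp
    linarith
  choose c hc using hint
  have hcG : ∀ i g u v w, c i (act g u) (act g v) (act g w) = c i u v w := fun i g u v w => by
    have : (c i (act g u) (act g v) (act g w) : ℝ) = c i u v w := by simp only [hc, hdG]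
    exact_mod_cast this
  have hcoc : ∀ i v w x y, c i w x y - c i v x y + c i v w y - c i v w x = 0 :=
    fun i v w x y => by
      have : (c i w x y - c i v x y + c i v w y - c i v w x : ℝ) = 0 := by
        simp only [hc]; ring
      exact_mod_cast this
  have hcsmall : ∀ i u v w, |d i v w| < 1 / 4 → |d i u w| < 1 / 4 → |d i u v| < 1 / 4 →
      c i u v w = 0 := fun i u v w h1 h2 h3 => by
    rw [abs_lt] at h1 h2 h3
    have h4 : (c i u v w : ℝ) < 1 := by rw [hc]; linarith
    have h5 : (-1 : ℝ) < c i u v w := by rw [hc]; linarith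
    have h6 : c i u v w < 1 := by exact_mod_cast h4
    have h7 : -1 < c i u v w := by exact_mod_cast h5
    omega
  let f := ev (cupProd (fun i u v w => (c i u v w : ZMod p)) l)
  have hfbd : ∀ a, f (bd a) = 0 := fun a => by
    have : f ∘ₗ bd = 0 := by
      refine Finsupp.lhom_ext' fun s => LinearMap.ext_ring ?_
      simp only [LinearMap.comp_apply, lsingle_apply, bd_single]
      exact ev_cupProd_face (fun i v w x y => by
        exact_mod_cast congrArg (Int.cast : ℤ → ZMod p) (hcoc i v w x y)) l s
    exact LinearMap.congr_fun this a
  have hfG : ∀ g a, f (map (act g) a) = f a := fun g a => by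
    simp only [f, ev_map, cupProd_map, hcG]
  -- a fine chain map from tuples of group elements
  obtain ⟨C, hC⟩ := Metric.isBounded_iff.1 hX.isBounded
  obtain ⟨j, hj⟩ : ∃ j : ℕ, (1 - (N : ℝ)⁻¹) ^ j * C < δ := by
    have hN1 : (1 : ℝ) ≤ N := by exact_mod_cast (by omega : 1 ≤ N)
    have h0 : 0 ≤ 1 - (N : ℝ)⁻¹ := sub_nonneg.2 (inv_le_one_of_one_le₀ hN1)
    have h1 : 1 - (N : ℝ)⁻¹ < 1 := by
      have : (0 : ℝ) < (N : ℝ)⁻¹ := by positivity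
      linarith
    have := (tendsto_pow_atTop_nhds_zero_of_lt_one h0 h1).mul_const C
    rw [zero_mul] at this
    exact (this.eventually (gt_mem_nhds hδ)).exists
  let Φ : (List G →₀ ZMod p) →ₗ[ZMod p] (List V →₀ ZMod p) :=
    ((subdiv (R := ZMod p) (apex : List V → V) : Module.End (ZMod p) (List V →₀ ZMod p)) ^ j) ∘ₗ
      subdiv joinApex
  have hΦapply : ∀ a, Φ a = (subdiv (R := ZMod p) apex)^[j] (subdiv joinApex a) := fun a => by
    simp only [Φ, LinearMap.comp_apply, Module.End.pow_apply]
  have hΦbd : ∀ a, bd (Φ a) = Φ (bd a) := fun a => by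
    rw [hΦapply, hΦapply, ← bd_subdiv]
    exact Function.Commute.iterate_right (fun b => bd_subdiv apex b) j _
  have hΦ0 : Φ (single [] 1) = single [] 1 := by
    rw [hΦapply, subdiv_nil]
    exact Function.iterate_fixed (subdiv_nil apex) j
  have hΦG : ∀ g a, map (act g) (Φ a) = Φ (tr p g a) := fun g a => by
    rw [hΦapply, hΦapply, ← map_subdiv joinApex (g + ·) (act g)]
    · refine Function.Commute.iterate_right (fun b => map_subdiv apex (act g) (act g) ?_ b) j _
      intro s hs
      obtain ⟨v, s, rfl⟩ := List.exists_cons_of_ne_nil hs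
      refine Prod.ext (by simp [apex, act]) ?_
      have key : ∀ t : List V, ((t.map (act g)).map Prod.snd).sum =
          shift g (t.map Prod.snd).sum := fun t => by
        induction t with
        | nil => rfl
        | cons w t ih =>
          rw [List.map_cons, List.map_cons, List.sum_cons, ih]
          rfl
      simp only [apex, key, List.length_map]
      rfl
    · intro s hs
      obtain ⟨v, s, rfl⟩ := List.exists_cons_of_ne_nil hs
      simp [joinApex, act, shift_vertex]
  have hfΦ : ∀ s, f (Φ (single s 1)) = 0 := fun s => by
    let L : (List V →₀ ZMod p) →ₗ[ZMod p] ZMod p := f ∘ₗ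
      ((subdiv (R := ZMod p) (apex : List V → V) : Module.End (ZMod p) (List V →₀ ZMod p)) ^ j)
    have hL : ∀ a, L a = f ((subdiv (R := ZMod p) (apex : List V → V))^[j] a) := fun a => by
      simp only [L, LinearMap.comp_apply, Module.End.pow_apply]
    have hfΦL : f (Φ (single s 1)) = L (subdiv joinApex (single s 1)) := rfl
    rw [hfΦL]
    refine (Submodule.mem_bot (ZMod p)).1
      (mem_of_supported L ⊥ ?_ (subdiv_joinApex_mem (R := ZMod p) (N := N) s))
    rintro t ⟨htlen, ht⟩
    rw [Submodule.mem_bot, hL]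
    by_cases hlen : s.length = N
    · obtain ⟨h, hh⟩ := ht hlen.le
      have htK : ∀ v ∈ t, v.2 ∈ joinFace h := fun v hv => by
        obtain ⟨i, -, hi⟩ := hh v hv
        rw [hi]
        exact vertex_mem_joinFace h i
      have hKX : joinFace h ⊆ X := Set.subset_iUnion joinFace h
      refine (Submodule.mem_bot (ZMod p)).1 (mem_of_supported f ⊥ ?_
        (iterate_subdiv_apex_mem (convex_joinFace h) htK
          (fun x hx y hy => hC (hKX (htK x hx)) (hKX (htK y hy))) j))
      rintro u ⟨hulen, huK, huD⟩
      rw [htlen, hlen] at huD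
      rw [Submodule.mem_bot]
      by_contra hne
      simp only [f, ev_single] at hne
      obtain ⟨hul, huc⟩ := of_cupProd_ne_zero _ l u hne
      obtain ⟨v, hv⟩ := List.exists_mem_of_length_pos (l := u) (by omega)
      obtain ⟨i, hi, hball⟩ := hδX v.2 (hKX (huK v hv))
      obtain ⟨x, hx, y, hy, z, hz, hxyz⟩ := huc i hi
      have hd : ∀ y ∈ u, ∀ z ∈ u, |d i y z| < 1 / 4 := fun y hy z hz => by
        have hyb : y.2 ∈ Metric.ball v.2 δ := (huD y hy v hv).trans_lt hj
        have hzb : z.2 ∈ Metric.ball v.2 δ := (huD z hz v hv).trans_lt hj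
        have hy0 : F i y.2 ≠ 0 := norm_pos_iff.1 ((norm_nonneg _).trans_lt (hball _ hyb _ hzb))
        have hz0 : F i z.2 ≠ 0 := norm_pos_iff.1 ((norm_nonneg _).trans_lt (hball _ hzb _ hyb))
        have hre : |(F' i z / F' i y).arg| < Real.pi / 2 := by
          rw [Complex.abs_arg_lt_pi_div_two_iff]
          left
          simp only [F', hy0, hz0, if_false]
          have h1 : ‖F i z.2 / F i y.2 - 1‖ < 1 := by
            rw [div_sub_one hy0, norm_div, div_lt_one (norm_pos_iff.2 hy0)]
            exact hball _ hyb _ hzb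
          have h2 := (abs_lt.1 ((Complex.abs_re_le_norm _).trans_lt h1)).1
          simp only [Complex.sub_re, Complex.one_re] at h2
          linarith
        simp only [d]
        rw [abs_div, abs_of_pos Real.two_pi_pos, div_lt_iff₀ Real.two_pi_pos]
        linarith
      exact hxyz (by rw [hcsmall i x y z (hd y hy z hz) (hd x hx z hz) (hd x hx y hy)]; simp)
    · obtain ⟨D, hD⟩ := Metric.isBounded_iff.1
        ((List.finite_toSet t).image Prod.snd).isBounded
      refine (Submodule.mem_bot (ZMod p)).1 (mem_of_supported f ⊥ ?_
        (iterate_subdiv_apex_mem (convex_univ) (fun v _ => Set.mem_univ v.2)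
          (fun x hx y hy => hD (Set.mem_image_of_mem _ hx) (Set.mem_image_of_mem _ hy)) j))
      rintro u ⟨hulen, -⟩
      rw [Submodule.mem_bot]
      by_contra hne
      simp only [f, ev_single] at hne
      have := (of_cupProd_ne_zero _ l u hne).1
      omega
  -- comparison with the vertices of the first factor
  let o : G → V := fun g => (g, 0)
  have hoact : ∀ g h, act g (o h) = o (g + h) := fun g h => rfl
  have hmapo : ∀ g a, map (act g) (map o a : List V →₀ ZMod p) = map o (tr p g a) := fun g a => by
    rw [tr, map_map, map_map]
    rfl
  let T : (List G →₀ ZMod p) →ₗ[ZMod p] (List V →₀ ZMod p) :=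
    homotopy (map o) Φ fun s => o (s.headD 0)
  have harg : ∀ a : ZMod p, ∃ m : ℤ, (ω a).arg / (2 * Real.pi) = (a.val : ℝ) / p + m := fun a => by
    have h1 : ω a = Complex.exp ((2 * Real.pi * (a.val / p) : ℝ) * Complex.I) := by
      simp only [ω, ZMod.stdAddChar_apply, ZMod.toCircle_apply]
      congr 1
      push_cast
      ring
    refine ⟨-toIocDiv Real.two_pi_pos (-Real.pi) (2 * Real.pi * (a.val / p)), ?_⟩
    rw [h1, Complex.arg_exp_mul_I, toIocMod, div_eq_iff Real.two_pi_pos.ne', zsmul_eq_mul]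
    push_cast
    ring
  choose m hm using harg
  have hdo : ∀ i g h, d i (o g) (o h) =
      ((χ i h - χ i g).val : ℝ) / p + m (χ i h - χ i g) := fun i g h => by
    have h1 : ∀ g, F' i (o g) = ω (χ i g) * F' i (o 0) := fun g => by
      rw [← hF'G, hoact, add_zero]
    rw [← hm]
    simp only [d]
    rw [h1 g, h1 h, mul_div_mul_right _ _ (hF'0 i _), AddChar.map_sub_eq_div]
  refine cupProd_not_coboundary χ θ hθ m (fun i x y z => c i (o x) (o y) (o z))
    (fun i x y z => by simp only [hc, hdo]) l (f ∘ₗ T) (fun g a => ?_) ?_ fun s => ?_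
  · rw [LinearMap.comp_apply, LinearMap.comp_apply, ← hfG g (T a)]
    congr 1
    refine (map_homotopy _ (g + ·) (act g) (hmapo g) (hΦG g) (fun s hs => ?_) a).symm
    obtain ⟨v, s, rfl⟩ := List.exists_cons_of_ne_nil hs
    rfl
  · simp only [LinearMap.comp_apply, T, homotopy_nil, map_zero]
  · have h1 := bd_homotopy (A := map o) (B := Φ) (fun a => (map_bd o a).symm) hΦbd
      (by rw [hΦ0]; simp) (fun s => o (s.headD 0)) (single s 1)
    have h2 := congrArg f h1
    rw [map_add, map_sub, hfbd, hfΦ, zero_add, sub_zero, bd_single, map_single, ev_single,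
      cupProd_map] at h2
    exact h2.symm

end Join

end OrderedChain

lemma isClosed_chessSpace (q : ℕ) : IsClosed (chessSpace q) := by
  have : chessSpace q = (⋂ v, {x | 0 ≤ x v}) ∩ {x | ∑ v, x v = 1} ∩
      ⋂ v, ⋂ w, {x | (v.1 = w.1 ∨ v.2 = w.2) ∧ v ≠ w → x v * x w = 0} := by
    ext x
    simp only [chessSpace, Set.mem_ofPred_eq, Set.mem_inter_iff, Set.mem_iInter, and_assoc]
    refine and_congr_right fun _ => and_congr_right fun _ => forall₂_congr fun v w => ?_
    rw [mul_eq_zero]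
    tauto
  rw [this]
  refine ((isClosed_iInter fun v => isClosed_le continuous_const (continuous_apply v)).inter
    (isClosed_eq (by fun_prop) continuous_const)).inter
    (isClosed_iInter fun v => isClosed_iInter fun w => ?_)
  by_cases hvw : (v.1 = w.1 ∨ v.2 = w.2) ∧ v ≠ w
  · simpa only [hvw, ne_eq, not_false_eq_true, and_self, forall_const] using
      isClosed_eq (by fun_prop) continuous_const
  · simp only [hvw, false_imp_iff]
    exact isClosed_univ

section Fourier

variable {p k : ℕ} [Fact p.Prime]

lemma sum_stdAddChar_dotProduct (g : Fin k → ZMod p) :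
    ∑ u : Fin k → ZMod p, (ZMod.stdAddChar (u ⬝ᵥ g) : ℂ) =
      if g = 0 then (Fintype.card (Fin k → ZMod p) : ℂ) else 0 := by
  let φ : (Fin k → ZMod p) →+ ZMod p := AddMonoidHom.mk' (· ⬝ᵥ g) fun u v => add_dotProduct u v g
  let ψ : AddChar (Fin k → ZMod p) ℂ := ZMod.stdAddChar.compAddMonoidHom φ
  have h := AddChar.sum_eq_ite ψ
  by_cases hg : g = 0
  · subst hg
    simp
  · have hψ : ψ ≠ 0 := fun h0 => by
      obtain ⟨i, hi⟩ := Function.ne_iff.1 hg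
      have h1 : ψ (Pi.single i 1) = 1 := by rw [h0]; rfl
      have h2 : ψ (Pi.single i 1) = ZMod.stdAddChar (g i) := by
        simp [ψ, φ]
      rw [h2, ← AddChar.map_zero_eq_one (ZMod.stdAddChar (N := p))] at h1
      exact hi (ZMod.injective_stdAddChar h1)
    rw [if_neg hψ] at h
    rw [if_neg hg, ← h]
    rfl

/-- A function on `(ℤ/p)^k` whose nontrivial Fourier coefficients vanish is constant. -/
lemma eq_of_forall_sum_stdAddChar_mul_eq_zero (a : (Fin k → ZMod p) → ℂ)
    (ha : ∀ u : Fin k → ZMod p, u ≠ 0 → ∑ g, (ZMod.stdAddChar (u ⬝ᵥ g) : ℂ) * a g = 0)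
    (g h : Fin k → ZMod p) : a g = a h := by
  have key : ∀ h, (Fintype.card (Fin k → ZMod p) : ℂ) * a h = ∑ g, a g := fun h => by
    have h1 : ∑ u : Fin k → ZMod p, (ZMod.stdAddChar (-(u ⬝ᵥ h)) : ℂ) *
        ∑ g, (ZMod.stdAddChar (u ⬝ᵥ g) : ℂ) * a g = ∑ g, a g := by
      rw [Finset.sum_eq_single 0]
      · simp
      · intro u _ hu
        rw [ha u hu, mul_zero]
      · simp
    rw [← h1]
    simp only [Finset.mul_sum]
    rw [Finset.sum_comm]
    have h2 : ∀ g, ∑ u : Fin k → ZMod p, (ZMod.stdAddChar (-(u ⬝ᵥ h)) : ℂ) *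
        ((ZMod.stdAddChar (u ⬝ᵥ g) : ℂ) * a g) =
          (if g - h = 0 then (Fintype.card (Fin k → ZMod p) : ℂ) else 0) * a g := fun g => by
      rw [← sum_stdAddChar_dotProduct, Finset.sum_mul]
      refine Finset.sum_congr rfl fun u _ => ?_
      rw [← mul_assoc, ← AddChar.map_add_eq_mul, dotProduct_sub, neg_add_eq_sub]
    simp only [h2, sub_eq_zero, ite_mul, zero_mul, Finset.sum_ite_eq', Finset.mem_univ, if_true]
  exact mul_left_cancel₀ (Nat.cast_ne_zero.2 Fintype.card_ne_zero) ((key g).trans (key h).symm)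

/-- An equivariant family on the join of `2 * q - 1` copies of `(ℤ/p)^k` is constant on an orbit. -/
lemma exists_forall_shift_eq {N : ℕ} (hN : N = 2 * p ^ k - 1)
    (P : (Fin N × (Fin k → ZMod p) → ℝ) → ℂ) (hP : Continuous P) :
    ∃ h : Fin N → Fin k → ZMod p, ∃ x ∈ OrderedChain.joinFace h, ∀ g g',
      P (OrderedChain.shift g x) = P (OrderedChain.shift g' x) := by
  let ι := {u : Fin k → ZMod p // u ≠ 0}
  let χ : ι → (Fin k → ZMod p) →+ ZMod p := fun u => AddMonoidHom.mk' (u.1 ⬝ᵥ ·) (dotProduct_add u.1)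
  have hθ : ∀ u : ι, ∃ θ : ZMod p →+ (Fin k → ZMod p), ∀ a, χ u (θ a) = a := fun u => by
    obtain ⟨i, hi⟩ := Function.ne_iff.1 u.2
    refine ⟨(AddMonoidHom.single (fun _ => ZMod p) i).comp (AddMonoidHom.mulLeft (u.1 i)⁻¹),
      fun a => ?_⟩
    simp only [χ, AddMonoidHom.mk'_apply, AddMonoidHom.comp_apply, AddMonoidHom.single_apply,
      AddMonoidHom.coe_mulLeft, dotProduct_single]
    exact mul_inv_cancel_left₀ hi a
  choose θ hθ using hθ
  have hshift : ∀ (g h : Fin k → ZMod p) (x : Fin N × (Fin k → ZMod p) → ℝ),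
      OrderedChain.shift g (OrderedChain.shift h x) = OrderedChain.shift (g + h) x :=
    fun g h x => by
      ext v
      simp [OrderedChain.shift, sub_sub]
  obtain ⟨h, x, hx, h0⟩ := OrderedChain.exists_common_zero χ θ hθ
    (Finset.univ : Finset ι).toList (N := N) (by
      have hpos : 0 < p ^ k := pow_pos (Fact.out (p := p.Prime)).pos k
      have h1 : Fintype.card ι = p ^ k - 1 := by
        simp [ι, Fintype.card_subtype_compl, ZMod.card]
      rw [Finset.length_toList, Finset.card_univ, h1]
      omega)
    (fun u x => ∑ g, (ZMod.stdAddChar (χ u g) : ℂ) * P (OrderedChain.shift (-g) x))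
    (fun u => by
      refine continuous_finsetSum _ fun g _ => continuous_const.mul (hP.comp ?_)
      exact continuous_pi fun v => continuous_apply _)
    (fun u g x => by
      rw [← Equiv.sum_comp (Equiv.addLeft g), Finset.mul_sum]
      refine Finset.sum_congr rfl fun g' _ => ?_
      have hneg : -(g + g') + g = -g' := by abel
      rw [Equiv.coe_addLeft, hshift, hneg, map_add, AddChar.map_add_eq_mul, mul_assoc])
  refine ⟨h, x, hx, fun g g' => ?_⟩
  have := eq_of_forall_sum_stdAddChar_mul_eq_zero (fun g => P (OrderedChain.shift (-g) x))
    (fun u hu => h0 ⟨u, hu⟩ (by simp)) (-g) (-g')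
  simpa only [neg_neg] using this

end Fourier

/-- consequence of Volovikov's theorem. Let `q = p^k` with `p` prime, `k ≥ 1`,
and `G = (ℤ_p)^k`, with `G` acting on `‖Δ_{2q−1,q}‖` by `g·(r,j) = (r, η⁻¹(g + η(j)))` (affinely
extended) and on the standard simplex `Δ^G` by affinely extending `g'·e_g = e_{g+g'}`. Then
every `G`-equivariant continuous map `f : ‖Δ_{2q−1,q}‖ → Δ^G` hits the barycenter
`(1/q)·Σ_{g∈G} e_g` of `Δ^G`. -/
theorem stmt1 (p k : ℕ) [hp : Fact p.Prime] (hk : 0 < k) (q : ℕ) (hq : q = p ^ k)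
    (η : Fin q ≃ (Fin k → ZMod p))
    (f : ((Fin (2 * q - 1) × Fin q) → ℝ) → ((Fin k → ZMod p) → ℝ))
    (hmaps : ∀ x ∈ chessSpace q, f x ∈ stdSimplex ℝ (Fin k → ZMod p))
    (hcont : ContinuousOn f (chessSpace q))
    (hequiv : ∀ g : Fin k → ZMod p, ∀ x ∈ chessSpace q,
      f (fun v => x (v.1, η.symm (η v.2 - g))) = fun g' => f x (g' - g)) :
    ∃ x₀ ∈ chessSpace q, f x₀ = fun _ => 1 / (q : ℝ) := by
  let R : (Fin (2 * q - 1) × (Fin k → ZMod p) → ℝ) → (Fin (2 * q - 1) × Fin q → ℝ) :=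
    fun x v => x (v.1, η v.2)
  have hR : Continuous R := continuous_pi fun v => continuous_apply _
  have hfR : ∀ x, R x ∈ chessSpace q → ∀ g,
      f (R (OrderedChain.shift (-g) x)) 0 = f (R x) g := fun x hx g => by
    have := congrFun (hequiv (-g) (R x) hx) 0
    simpa [R, OrderedChain.shift] using this
  have hRshift : ∀ x, R x ∈ chessSpace q → ∀ g, R (OrderedChain.shift g x) ∈ chessSpace q := by
    rintro x ⟨h0, h1, h2⟩ g
    let e : Fin q ≃ Fin q := (η.trans (Equiv.subRight g)).trans η.symm
    have he : R (OrderedChain.shift g x) = fun v => R x (v.1, e v.2) := by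
      ext v
      simp [R, e, OrderedChain.shift]
    rw [he]
    refine ⟨fun v => h0 _, ?_, fun v w hv hw hvw => ?_⟩
    · rw [← h1]
      exact Equiv.sum_comp ((Equiv.refl _).prodCongr e) (R x)
    · have := h2 _ _ hv hw (hvw.imp id fun h => congrArg e h)
      simpa [Prod.ext_iff] using this
  obtain ⟨F, hF⟩ := ContinuousMap.exists_restrict_eq (isClosed_chessSpace q)
    ⟨fun x : chessSpace q => f x 0,
      (continuous_apply 0).comp (continuousOn_iff_continuous_domRestrict.1 hcont)⟩
  have hFf : ∀ x ∈ chessSpace q, F x = f x 0 := fun x hx => congrArg (fun φ => φ ⟨x, hx⟩) hF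
  let D : (Fin (2 * q - 1) × (Fin k → ZMod p) → ℝ) → ℝ :=
    fun x => ∑ i, ∑ j, if i = j then 0 else x (i, 0) * x (j, 0)
  have hD : Continuous D := by
    refine continuous_finsetSum _ fun i _ => continuous_finsetSum _ fun j _ => ?_
    split_ifs <;> fun_prop
  obtain ⟨h, x, ⟨hx0, hx1, hx2⟩, hP⟩ := exists_forall_shift_eq (p := p) (k := k) (N := 2 * q - 1)
    (by rw [hq]) (fun x => (F (R x) : ℂ) + D x * Complex.I) (by fun_prop)
  have hconst : ∀ g g', F (R (OrderedChain.shift g x)) = F (R (OrderedChain.shift g' x)) :=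
    fun g g' => by simpa using congrArg Complex.re (hP g g')
  have hDconst : ∀ g g', D (OrderedChain.shift g x) = D (OrderedChain.shift g' x) :=
    fun g g' => by simpa using congrArg Complex.im (hP g g')
  have hDshift : ∀ g, D (OrderedChain.shift (-g) x) =
      ∑ i, ∑ j, if i = j then 0 else x (i, g) * x (j, g) := fun g => by
    simp [D, OrderedChain.shift]
  have hcard : Fintype.card (Fin k → ZMod p) = q := by simp [hq, ZMod.card]
  have hqpos : 0 < q := hq ▸ pow_pos hp.out.pos k
  obtain ⟨a, ha⟩ := Fintype.exists_card_fiber_lt_of_card_lt_mul h (n := 2)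
    (by rw [hcard, Fintype.card_fin]; omega)
  have hDa : D (OrderedChain.shift (-a) x) = 0 := by
    rw [hDshift]
    refine Finset.sum_eq_zero fun i _ => Finset.sum_eq_zero fun j _ => ?_
    by_cases hij : i = j
    · rw [if_pos hij]
    rw [if_neg hij]
    by_contra hne
    obtain ⟨hi, hj⟩ := mul_ne_zero_iff.1 hne
    exact hij (Finset.card_le_one.1 (Nat.lt_succ_iff.1 ha) i (by simp [hx2 i a hi]) j
      (by simp [hx2 j a hj]))
  have hcol : ∀ g i j, i ≠ j → x (i, g) * x (j, g) = 0 := fun g i j hij => by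
    have hnn : ∀ i j, 0 ≤ if i = j then 0 else x (i, g) * x (j, g) := fun i j => by
      split_ifs
      · exact le_rfl
      · exact mul_nonneg (hx0 _) (hx0 _)
    have h1 := hDshift g
    rw [hDconst (-g) (-a), hDa, eq_comm,
      Finset.sum_eq_zero_iff_of_nonneg fun i _ => Finset.sum_nonneg fun j _ => hnn i j] at h1
    have h2 := h1 i (Finset.mem_univ i)
    rw [Finset.sum_eq_zero_iff_of_nonneg fun j _ => hnn i j] at h2
    simpa [hij] using h2 j (Finset.mem_univ j)
  have hxR : R x ∈ chessSpace q := by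
    refine ⟨fun v => hx0 _, ?_, fun v w hv hw hvw => ?_⟩
    · rw [← hx1]
      exact Equiv.sum_comp ((Equiv.refl _).prodCongr η) x
    · rcases hvw with hrow | hcolumn
      · refine Prod.ext hrow (η.injective ?_)
        rw [hx2 _ _ hv, hx2 _ _ hw, hrow]
      · refine Prod.ext ?_ hcolumn
        by_contra hne
        have hw' : x (w.1, η v.2) ≠ 0 := by rwa [hcolumn]
        exact mul_ne_zero hv hw' (hcol _ _ _ hne)
  refine ⟨R x, hxR, funext fun g => ?_⟩
  have hg : ∀ g', f (R x) g' = f (R x) g := fun g' => by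
    rw [← hfR x hxR, ← hfR x hxR, ← hFf _ (hRshift x hxR _), ← hFf _ (hRshift x hxR _)]
    exact hconst _ _
  have hsum := (hmaps (R x) hxR).2
  rw [Finset.sum_congr rfl fun g' _ => hg g', Finset.sum_const, Finset.card_univ, hcard,
    nsmul_eq_mul] at hsum
  rw [eq_div_iff (by positivity), mul_comm]
  exact hsum
end

section
/- Consider a one-layered cake (the interval [0,1]) and n ≥ 3 agents whose valuation functions v_1,…,v_n are monotone and K-Lipschitz (agent n being the 'birthday agent'). Let k_1, k_2, k_3 be positive integers with k_1 + k_2 + k_3 = n. Then for every ε > 0, setting N = ⌈6K/ε⌉, there exist 0 ≤ a ≤ b ≤ 1, both integer multiples of 1/N, such that the contiguous division A = ([0,a], [a,b], [b,1]) of [0,1] into three pieces satisfies: for every j* ∈ {1,2,3} there is an assignment π : [n] → {1,2,3} with π(n) = j*; for every i ∈ [n−1], v_i(A_{π(i)}) + ε ≥ max_{j∈{1,2,3}} v_i(A_j); and for every j ∈ {1,2,3}, |π⁻¹(j)| = k_j. (The paper moreover shows such a division can be computed in time O(n·log²(K/ε)).) -/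
open MeasureTheory

/-- A piece of cake: a finite union of closed subintervals of `[0,1]`. -/
def IsPiece (S : Set ℝ) : Prop :=
  ∃ I : Finset (ℝ × ℝ), (∀ p ∈ I, 0 ≤ p.1 ∧ p.2 ≤ 1) ∧ S = ⋃ p ∈ I, Set.Icc p.1 p.2

/-- The contiguous division `([0,a], [a,b], [b,1])` of the one-layered cake `[0,1]`. -/
def divB (a b : ℝ) : Fin 3 → Set ℝ := ![Set.Icc 0 a, Set.Icc a b, Set.Icc b 1]

section Sperner

/-- The indicator, modulo `2`, that an edge has endpoint colours `0` and `1`. -/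
def edgeParity (x y : Fin 3) : ZMod 2 :=
  if (x = 0 ∧ y = 1) ∨ (x = 1 ∧ y = 0) then 1 else 0

lemma edgeParity_triangle : ∀ x y z : Fin 3, (∃ j, x ≠ j ∧ y ≠ j ∧ z ≠ j) →
    edgeParity x y + edgeParity y z + edgeParity x z = 0 := by
  decide

lemma edgeParity_eq_zero_of_ne_zero : ∀ x y : Fin 3, x ≠ 0 → y ≠ 0 → edgeParity x y = 0 := by
  decide

lemma edgeParity_eq_zero_of_ne_one : ∀ x y : Fin 3, x ≠ 1 → y ≠ 1 → edgeParity x y = 0 := by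
  decide

/-- Sperner's lemma for the triangular grid `{(p, q) | p ≤ q ≤ N}`: the three points `y` are
pairwise at sup-distance at most one and carry all three colours. -/
lemma exists_rainbow_triangle {N : ℕ} (c : ℕ → ℕ → Fin 3)
    (h0 : ∀ q ≤ N, c 0 q ≠ 0) (h1 : ∀ q ≤ N, c q q ≠ 1) (h2 : ∀ p ≤ N, c p N ≠ 2) :
    ∃ y : Fin 3 → ℕ × ℕ, (∀ j, ∃ t, c (y t).1 (y t).2 = j) ∧
      (∀ t, (y t).1 ≤ (y t).2 ∧ (y t).2 ≤ N) ∧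
      ∀ s t, (y s).1 ≤ (y t).1 + 1 ∧ (y s).2 ≤ (y t).2 + 1 := by
  by_contra hno
  have rainbow : ∀ x y z : ℕ × ℕ, (∀ t, (![x, y, z] t).1 ≤ (![x, y, z] t).2 ∧
      (![x, y, z] t).2 ≤ N) → (∀ s t, (![x, y, z] s).1 ≤ (![x, y, z] t).1 + 1 ∧
      (![x, y, z] s).2 ≤ (![x, y, z] t).2 + 1) →
      edgeParity (c x.1 x.2) (c y.1 y.2) + edgeParity (c y.1 y.2) (c z.1 z.2)
        + edgeParity (c x.1 x.2) (c z.1 z.2) = 0 := by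
    intro x y z hm hd
    apply edgeParity_triangle
    by_contra hc
    push Not at hc
    refine hno ⟨![x, y, z], fun j => ?_, hm, hd⟩
    by_cases hx : c x.1 x.2 = j
    · exact ⟨0, hx⟩
    by_cases hy : c y.1 y.2 = j
    · exact ⟨1, hy⟩
    exact ⟨2, hc j hx hy⟩
  have upper : ∀ p q, p ≤ q → q < N →
      edgeParity (c p q) (c p (q + 1)) + edgeParity (c p (q + 1)) (c (p + 1) (q + 1))
        + edgeParity (c p q) (c (p + 1) (q + 1)) = 0 := fun p q hp hq =>
    rainbow (p, q) (p, q + 1) (p + 1, q + 1)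
      (by simp [Fin.forall_fin_succ]; omega) (by simp [Fin.forall_fin_succ]; omega)
  have lower : ∀ p q, p < q → q < N →
      edgeParity (c p q) (c (p + 1) q) + edgeParity (c (p + 1) q) (c (p + 1) (q + 1))
        + edgeParity (c p q) (c (p + 1) (q + 1)) = 0 := fun p q hp hq =>
    rainbow (p, q) (p + 1, q) (p + 1, q + 1)
      (by simp [Fin.forall_fin_succ]; omega) (by simp [Fin.forall_fin_succ]; omega)
  have two : ∀ x : ZMod 2, x + x = 0 := by decide
  have strip : ∀ q < N, ∀ m ≤ q,
      ∑ p ∈ Finset.range m, edgeParity (c p q) (c (p + 1) q) +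
        ∑ p ∈ Finset.range (m + 1), edgeParity (c p (q + 1)) (c (p + 1) (q + 1)) =
      edgeParity (c m q) (c (m + 1) (q + 1)) := by
    intro q hq m
    induction m with
    | zero =>
      intro _
      have h := upper 0 q (Nat.zero_le _) hq
      rw [edgeParity_eq_zero_of_ne_zero _ _ (h0 q hq.le) (h0 (q + 1) hq)] at h
      simp only [Finset.range_zero, Finset.sum_empty, zero_add, Finset.range_one,
        Finset.sum_singleton] at h ⊢
      linear_combination h - two (edgeParity (c 0 q) (c 1 (q + 1)))
    | succ m ih =>
      intro hm
      rw [Finset.sum_range_succ, Finset.sum_range_succ _ (m + 1)]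
      have hu := upper (m + 1) q hm hq
      have hl := lower m q hm hq
      linear_combination ih (by omega) + hu + hl
        - two (edgeParity (c (m + 1) q) (c (m + 1 + 1) (q + 1)))
        - two (edgeParity (c m q) (c (m + 1) (q + 1)))
        - two (edgeParity (c (m + 1) q) (c (m + 1) (q + 1)))
        + two (edgeParity (c m q) (c (m + 1) (q + 1)))
  have row : ∀ q ≤ N, ∑ p ∈ Finset.range q, edgeParity (c p q) (c (p + 1) q) = 0 := by
    intro q
    induction q with
    | zero => simp
    | succ q ih =>
      intro hq
      have h := strip q hq q le_rfl
      rwa [ih (by omega), zero_add,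
        edgeParity_eq_zero_of_ne_one _ _ (h1 q (by omega)) (h1 (q + 1) hq)] at h
  have top : ∀ m ≤ N, ∑ p ∈ Finset.range m, edgeParity (c p N) (c (p + 1) N) =
      if c m N = 0 then 1 else 0 := by
    intro m
    induction m with
    | zero => simp [h0 N le_rfl]
    | succ m ih =>
      intro hm
      rw [Finset.sum_range_succ, ih (by omega)]
      have key : ∀ x y : Fin 3, x ≠ 2 → y ≠ 2 →
          (if x = 0 then 1 else 0) + edgeParity x y = if y = 0 then 1 else 0 := by decide
      exact key _ _ (h2 m (by omega)) (h2 (m + 1) hm)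
  have hlast : c N N = 0 := by
    have key : ∀ x : Fin 3, x ≠ 1 → x ≠ 2 → x = 0 := by decide
    exact key _ (h1 N le_rfl) (h2 N le_rfl)
  have h := top N le_rfl
  rw [row N le_rfl, if_pos hlast] at h
  exact zero_ne_one h

end Sperner

section Assignment

/-- Hall's theorem for assigning agents to groups of prescribed sizes. -/
lemma exists_assignment_of_hall {α ι : Type*} [Fintype α] [DecidableEq α] [Fintype ι]
    [DecidableEq ι] (k : ι → ℕ) (hsum : ∑ j, k j = Fintype.card α) (L : α → Finset ι)
    (hall : ∀ T : Finset ι, (Finset.univ.filter fun i => L i ⊆ T).card ≤ ∑ j ∈ T, k j) :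
    ∃ π : α → ι, (∀ i, π i ∈ L i) ∧
      ∀ j, (Finset.univ.filter fun i => π i = j).card = k j := by
  obtain ⟨f, hf, hmem⟩ := (Finset.all_card_le_biUnion_card_iff_exists_injective
    (fun i => (L i).sigma fun j => (Finset.univ : Finset (Fin (k j))))).1 (by
      intro S
      have hS : S ⊆ Finset.univ.filter fun i => L i ⊆ S.biUnion L := fun i hi =>
        Finset.mem_filter.2 ⟨Finset.mem_univ _, Finset.subset_biUnion_of_mem L hi⟩
      refine (Finset.card_le_card hS).trans ((hall _).trans (le_of_eq ?_))
      have : (S.biUnion fun i => (L i).sigma fun j => (Finset.univ : Finset (Fin (k j)))) =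
          (S.biUnion L).sigma fun j => (Finset.univ : Finset (Fin (k j))) := by
        ext x; simp
      rw [this, Finset.card_sigma]
      simp)
  have hbij : Function.Bijective f :=
    (Fintype.bijective_iff_injective_and_card f).2 ⟨hf, by simp [hsum]⟩
  refine ⟨fun i => (f i).1, fun i => (Finset.mem_sigma.1 (hmem i)).1, fun j => ?_⟩
  rw [← Fintype.card_fin (k j), ← Finset.card_univ]
  symm
  refine Finset.card_bij (fun x _ => (Equiv.ofBijective f hbij).symm ⟨j, x⟩) ?_ ?_ ?_
  · intro x _
    have : f ((Equiv.ofBijective f hbij).symm ⟨j, x⟩) = ⟨j, x⟩ :=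
      (Equiv.ofBijective f hbij).apply_symm_apply _
    simp [this]
  · intro x _ y _ h
    simpa using h
  · intro i hi
    obtain rfl : (f i).1 = j := (Finset.mem_filter.1 hi).2
    exact ⟨(f i).2, Finset.mem_univ _, (Equiv.ofBijective f hbij).symm_apply_apply i⟩

/-- If three labellings `l` of the agents other than `z` are such that the number of agents
labelled `j` is below `k j` for one labelling and at least `k j` for another, then each of those
agents can be given one of its labels, and `z` an arbitrary one, with group sizes `k`. -/
lemma exists_assignment_of_labellings {α τ : Type*} [Fintype α] [DecidableEq α] [Fintype τ]
    [Nonempty τ] (z : α) (k : Fin 3 → ℕ) (hsum : ∑ j, k j = Fintype.card α)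
    (l : τ → α → Fin 3)
    (hlt : ∀ j, ∃ t, ((Finset.univ.erase z).filter fun i => l t i = j).card < k j)
    (hge : ∀ j, ∃ t, k j ≤ ((Finset.univ.erase z).filter fun i => l t i = j).card)
    (jstar : Fin 3) :
    ∃ π : α → Fin 3, π z = jstar ∧ (∀ i ≠ z, ∃ t, π i = l t i) ∧
      ∀ j, (Finset.univ.filter fun i => π i = j).card = k j := by
  obtain ⟨π, hπ, hcard⟩ := exists_assignment_of_hall k hsum
    (fun i => if i = z then {jstar} else Finset.univ.image fun t => l t i) (by
      intro T
      have hcases : T = ∅ ∨ T = Finset.univ ∨ ∃ j, T = {j} ∨ T = {j}ᶜ := by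
        revert T; decide
      have reduce : (∃ t, ((Finset.univ.erase z).filter fun i => l t i ∈ T).card
          < ∑ j ∈ T, k j) → (Finset.univ.filter fun i =>
          (if i = z then {jstar} else Finset.univ.image fun t => l t i) ⊆ T).card
            ≤ ∑ j ∈ T, k j := by
        rintro ⟨t, ht⟩
        refine le_trans ?_ (Nat.succ_le_of_lt ht)
        refine le_trans (Finset.card_le_card ?_) (Finset.card_insert_le z _)
        intro i hi
        have hi := (Finset.mem_filter.1 hi).2
        by_cases hz : i = z
        · simp [hz]
        · rw [if_neg hz] at hi
          simp [hz, hi (Finset.mem_image_of_mem _ (Finset.mem_univ t))]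
      rcases hcases with rfl | rfl | ⟨j, rfl | rfl⟩
      · rw [Finset.sum_empty, Nat.le_zero, Finset.card_eq_zero, Finset.filter_eq_empty_iff]
        intro i _ h
        rw [Finset.subset_empty] at h
        split_ifs at h
        · simp at h
        · simp [Finset.univ_eq_empty_iff] at h
      · rw [hsum]
        exact Finset.card_le_univ _
      · obtain ⟨t, ht⟩ := hlt j
        exact reduce ⟨t, by simpa using ht⟩
      · obtain ⟨t, ht⟩ := hge j
        refine reduce ⟨t, ?_⟩
        have hk : ∑ x ∈ ({j} : Finset (Fin 3))ᶜ, k x + k j = Fintype.card α := by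
          rw [← hsum, ← Finset.sum_compl_add_sum {j}, Finset.sum_singleton]
        have hc := Finset.card_filter_add_card_filter_not (s := Finset.univ.erase z)
          (fun i => l t i = j)
        rw [Finset.card_erase_of_mem (Finset.mem_univ z), Finset.card_univ] at hc
        have hpos : 0 < Fintype.card α := Fintype.card_pos_iff.2 ⟨z⟩
        simp only [Finset.mem_compl, Finset.mem_singleton]
        omega)
  refine ⟨π, by simpa using hπ z, fun i hi => ?_, hcard⟩
  have h := hπ i
  simp only [if_neg hi, Finset.mem_image, Finset.mem_univ, true_and] at h
  obtain ⟨t, ht⟩ := h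
  exact ⟨t, ht.symm⟩

/-- Groups of positive sizes `k` can be formed with a given agent in a given group. -/
lemma exists_assignment_of_pos {α ι : Type*} [Fintype α] [DecidableEq α] [Fintype ι]
    [DecidableEq ι] (z : α) (k : ι → ℕ) (hk : ∀ j, 0 < k j)
    (hsum : ∑ j, k j = Fintype.card α) (jstar : ι) :
    ∃ π : α → ι, π z = jstar ∧ ∀ j, (Finset.univ.filter fun i => π i = j).card = k j := by
  obtain ⟨π, hπ, hcard⟩ := exists_assignment_of_hall k hsum
    (fun i => if i = z then {jstar} else Finset.univ) (by
      intro T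
      by_cases hT : T = Finset.univ
      · rw [hT, hsum]
        exact Finset.card_le_univ _
      have hz : ∀ i ∈ Finset.univ.filter
          fun i => (if i = z then {jstar} else Finset.univ) ⊆ T, i = z := by
        intro i hi
        by_contra h
        exact hT (by simpa [h] using hi)
      by_cases hj : jstar ∈ T
      · calc _ ≤ ({z} : Finset α).card :=
              Finset.card_le_card fun i hi => Finset.mem_singleton.2 (hz i hi)
          _ ≤ k jstar := hk jstar
          _ ≤ _ := Finset.single_le_sum (fun _ _ => Nat.zero_le _) hj
      · rw [Finset.card_eq_zero.2]
        · exact Nat.zero_le _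
        · refine Finset.eq_empty_of_forall_notMem fun i hi => ?_
          obtain rfl := hz i hi
          simp [hj] at hi)
  exact ⟨π, by simpa using hπ z, hcard⟩

end Assignment

section Cake

lemma isPiece_Icc {a b : ℝ} (ha : 0 ≤ a) (hb : b ≤ 1) : IsPiece (Set.Icc a b) :=
  ⟨{(a, b)}, by simp [ha, hb], by simp⟩

lemma isPiece_empty : IsPiece ∅ := ⟨∅, by simp, by simp⟩

lemma divB_eq_Icc (a b : ℝ) (j : Fin 3) :
    divB a b j = Set.Icc (![0, a, b] j) (![a, b, 1] j) := by
  fin_cases j <;> rfl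

lemma isPiece_divB {a b : ℝ} (ha : 0 ≤ a) (hab : a ≤ b) (hb : b ≤ 1) (j : Fin 3) :
    IsPiece (divB a b j) := by
  rw [divB_eq_Icc]
  fin_cases j
  · exact isPiece_Icc le_rfl (hab.trans hb)
  · exact isPiece_Icc ha hb
  · exact isPiece_Icc (ha.trans hab) le_rfl

lemma volume_symmDiff_Icc_le (a b a' b' : ℝ) :
    (volume (symmDiff (Set.Icc a b) (Set.Icc a' b'))).toReal ≤ |a - a'| + |b - b'| := by
  have hsub : symmDiff (Set.Icc a b) (Set.Icc a' b') ⊆ Set.uIcc a a' ∪ Set.uIcc b b' := by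
    intro x hx
    simp only [Set.mem_symmDiff, Set.mem_Icc, Set.mem_union, Set.mem_uIcc] at hx ⊢
    grind
  refine ENNReal.toReal_le_of_le_ofReal (by positivity) ?_
  refine (measure_mono hsub).trans ((measure_union_le _ _).trans ?_)
  rw [Real.volume_interval, Real.volume_interval, ← ENNReal.ofReal_add (abs_nonneg _) (abs_nonneg _),
    abs_sub_comm a' a, abs_sub_comm b' b]

variable {K : ℝ} {w : Set ℝ → ℝ}

lemma abs_divB_sub_le (hK : 0 ≤ K)
    (hlip : ∀ L L' : Set ℝ, IsPiece L → IsPiece L' →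
      |w L - w L'| ≤ K * (volume (symmDiff L L')).toReal)
    {a b a' b' : ℝ} (ha : 0 ≤ a) (hab : a ≤ b) (hb : b ≤ 1) (ha' : 0 ≤ a') (hab' : a' ≤ b')
    (hb' : b' ≤ 1) (j : Fin 3) :
    |w (divB a b j) - w (divB a' b' j)| ≤ K * (|a - a'| + |b - b'|) := by
  refine (hlip _ _ (isPiece_divB ha hab hb j) (isPiece_divB ha' hab' hb' j)).trans ?_
  refine mul_le_mul_of_nonneg_left ?_ hK
  rw [divB_eq_Icc, divB_eq_Icc]
  refine (volume_symmDiff_Icc_le _ _ _ _).trans ?_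
  have h1 := abs_nonneg (a - a')
  have h2 := abs_nonneg (b - b')
  fin_cases j <;> simp

/-- Among the pieces of positive length there is one that is best among all three pieces. -/
lemma exists_favourite
    (hmono : ∀ L L' : Set ℝ, IsPiece L → IsPiece L' → L ⊆ L' → w L ≤ w L')
    (hlip : ∀ L L' : Set ℝ, IsPiece L → IsPiece L' →
      |w L - w L'| ≤ K * (volume (symmDiff L L')).toReal)
    {a b : ℝ} (ha : 0 ≤ a) (hab : a ≤ b) (hb : b ≤ 1) :
    ∃ j : Fin 3, (![0, a, b] j : ℝ) < ![a, b, 1] j ∧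
      ∀ j', w (divB a b j') ≤ w (divB a b j) := by
  have hne : (Finset.univ.filter fun j : Fin 3 => (![0, a, b] j : ℝ) < ![a, b, 1] j).Nonempty := by
    by_contra hempty
    rw [Finset.not_nonempty_iff_eq_empty, Finset.filter_eq_empty_iff] at hempty
    have h0 := hempty (Finset.mem_univ 0)
    have h1 := hempty (Finset.mem_univ 1)
    have h2 := hempty (Finset.mem_univ 2)
    simp at h0 h1 h2
    linarith
  obtain ⟨j, hj, hmax⟩ := Finset.exists_max_image _ (fun j => w (divB a b j)) hne
  refine ⟨j, (Finset.mem_filter.1 hj).2, fun j' => ?_⟩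
  by_cases hj' : (![0, a, b] j' : ℝ) < ![a, b, 1] j'
  · exact hmax j' (by simpa using hj')
  · have hvol : volume (divB a b j') = 0 := by
      rw [divB_eq_Icc, Real.volume_Icc, ENNReal.ofReal_eq_zero]
      linarith
    have h1 := hlip _ _ (isPiece_divB ha hab hb j') isPiece_empty
    rw [← Set.bot_eq_empty, symmDiff_bot, hvol, ENNReal.toReal_zero, mul_zero,
      Set.bot_eq_empty] at h1
    have h2 := hmono _ _ isPiece_empty (isPiece_divB ha hab hb j) (Set.empty_subset _)
    linarith [le_abs_self (w (divB a b j') - w ∅)]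

end Cake

/-- Theorem: FPTAS for the one-layered cake among three groups of given
sizes. For `n ≥ 3` agents whose valuations on pieces of `[0,1]` are monotone and
`K`-Lipschitz (agent `n` being the birthday agent), positive integers `k_1 + k_2 + k_3 = n`,
and every `ε > 0`, setting `N = ⌈6K/ε⌉`, there are `0 ≤ a ≤ b ≤ 1`, both integer multiples of
`1/N`, such that the contiguous division `A = ([0,a],[a,b],[b,1])` satisfies: for every
`j* ∈ {1,2,3}` there is an assignment `π : [n] → {1,2,3}` with `π(n) = j*`,
`v_i(A_{π(i)}) + ε ≥ max_j v_i(A_j)` for every non-birthday agent `i`, and exactly `k_j`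
agents assigned to piece `j`. -/
theorem stmt5 (n : ℕ) (hn : 3 ≤ n) (K : ℝ)
    (v : Fin n → Set ℝ → ℝ)
    (hmono : ∀ i (L L' : Set ℝ), IsPiece L → IsPiece L' → L ⊆ L' → v i L ≤ v i L')
    (hlip : ∀ i (L L' : Set ℝ), IsPiece L → IsPiece L' →
      |v i L - v i L'| ≤ K * (volume (symmDiff L L')).toReal)
    (k : Fin 3 → ℕ) (hk : ∀ j, 0 < k j) (hksum : ∑ j, k j = n)
    (ε : ℝ) (hε : 0 < ε) :
    ∃ a b : ℝ, 0 ≤ a ∧ a ≤ b ∧ b ≤ 1 ∧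
      (∃ ka : ℕ, a = (ka : ℝ) / (⌈6 * K / ε⌉₊ : ℝ)) ∧
      (∃ kb : ℕ, b = (kb : ℝ) / (⌈6 * K / ε⌉₊ : ℝ)) ∧
      ∀ jstar : Fin 3, ∃ π : Fin n → Fin 3,
        π ⟨n - 1, by omega⟩ = jstar ∧
        (∀ i : Fin n, (i : ℕ) < n - 1 → ∀ j : Fin 3,
          v i (divB a b j) ≤ v i (divB a b (π i)) + ε) ∧
        (∀ j : Fin 3, (Finset.univ.filter fun i => π i = j).card = k j) := by
  have hK : 0 ≤ K := by
    have h := (abs_nonneg _).trans (hlip ⟨0, by omega⟩ (Set.Icc 0 1) ∅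
      (isPiece_Icc le_rfl le_rfl) isPiece_empty)
    rw [← Set.bot_eq_empty, symmDiff_bot, Real.volume_Icc] at h
    simpa using h
  set z : Fin n := ⟨n - 1, by omega⟩
  have hcard : ∑ j, k j = Fintype.card (Fin n) := by rw [hksum, Fintype.card_fin]
  have ne_last : ∀ i : Fin n, (i : ℕ) < n - 1 → i ≠ z := by
    rintro i hi rfl
    exact lt_irrefl _ hi
  rcases hK.eq_or_lt with rfl | hK0
  · refine ⟨0, 0, le_rfl, le_rfl, zero_le_one, ⟨0, by simp⟩, ⟨0, by simp⟩, fun jstar => ?_⟩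
    obtain ⟨π, hπ, hsize⟩ := exists_assignment_of_pos z k hk hcard jstar
    refine ⟨π, hπ, fun i _ j => ?_, hsize⟩
    have h := hlip i _ _ (isPiece_divB le_rfl le_rfl zero_le_one j)
      (isPiece_divB le_rfl le_rfl zero_le_one (π i))
    rw [zero_mul] at h
    linarith [le_abs_self (v i (divB 0 0 j) - v i (divB 0 0 (π i)))]
  set N : ℕ := ⌈6 * K / ε⌉₊
  have hN : 0 < N := Nat.ceil_pos.2 (by positivity)
  have hNR : (0 : ℝ) < N := Nat.cast_pos.2 hN
  have hKN : K / N ≤ ε / 6 := by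
    have h : 6 * K / ε ≤ N := Nat.le_ceil _
    rw [div_le_iff₀ hε] at h
    rw [div_le_iff₀ hNR]
    linarith
  have hgrid : ∀ p q : ℕ, p ≤ q → q ≤ N →
      (0 : ℝ) ≤ p / N ∧ (p / N : ℝ) ≤ q / N ∧ (q / N : ℝ) ≤ 1 := by
    intro p q hp hq
    refine ⟨by positivity, by gcongr, ?_⟩
    rw [div_le_one hNR]
    exact_mod_cast hq
  have hfav : ∀ (p q : ℕ) (i : Fin n), ∃ j : Fin 3, p ≤ q → q ≤ N →
      ![(0 : ℝ), p / N, q / N] j < ![(p / N : ℝ), q / N, 1] j ∧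
      ∀ j', v i (divB (p / N) (q / N) j') ≤ v i (divB (p / N) (q / N) j) := by
    intro p q i
    by_cases h : p ≤ q ∧ q ≤ N
    · obtain ⟨h0, h1, h2⟩ := hgrid p q h.1 h.2
      obtain ⟨j, hj⟩ := exists_favourite (hmono i) (hlip i) h0 h1 h2
      exact ⟨j, fun _ _ => hj⟩
    · exact ⟨0, fun h1 h2 => absurd ⟨h1, h2⟩ h⟩
  choose l hl using hfav
  set F : ℕ → ℕ → Fin 3 → ℕ := fun p q j =>
    ((Finset.univ.erase z).filter fun i => l p q i = j).card with hF
  have hFsum : ∀ p q, F p q 0 + F p q 1 + F p q 2 + 1 = n := by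
    intro p q
    have h := Finset.card_eq_sum_card_fiberwise (s := Finset.univ.erase z)
      (t := (Finset.univ : Finset (Fin 3))) (f := l p q) (fun _ _ => Finset.mem_univ _)
    rw [Finset.card_erase_of_mem (Finset.mem_univ z), Finset.card_univ, Fintype.card_fin,
      Fin.sum_univ_three] at h
    simp only [hF]
    omega
  have hcol : ∀ p q, ∃ j : Fin 3, k j ≤ F p q j ∧ F p q (j + 2) < k (j + 2) := by
    intro p q
    by_contra! hc
    have h0 := hc 0
    have h1 := hc 1
    have h2 := hc 2
    have hs := hFsum p q
    rw [Fin.sum_univ_three] at hksum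
    simp only [Fin.isValue, zero_add, show (1 : Fin 3) + 2 = 0 from rfl,
      show (2 : Fin 3) + 2 = 1 from rfl] at h0 h1 h2
    have := hk 0
    have := hk 1
    have := hk 2
    omega
  choose c hc using hcol
  have hface : ∀ p q (j : Fin 3), p ≤ q → q ≤ N →
      ![(p / N : ℝ), q / N, 1] j ≤ ![(0 : ℝ), p / N, q / N] j → c p q ≠ j := by
    rintro p q _ hp hq hj rfl
    refine absurd ((hk _).trans_le (hc p q).1) (Nat.not_lt.2 (Nat.le_zero.2 ?_))
    rw [Finset.card_eq_zero, Finset.filter_eq_empty_iff]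
    intro i _ h
    have := (hl p q i hp hq).1
    rw [h] at this
    exact absurd hj (not_le.2 this)
  obtain ⟨y, hrain, hmem, hdist⟩ := exists_rainbow_triangle c
    (fun q hq => hface 0 q 0 (Nat.zero_le _) hq (by simp))
    (fun q hq => hface q q 1 le_rfl hq (by simp))
    (fun p hp => hface p N 2 hp le_rfl (by simp [hNR.ne']))
  obtain ⟨g0, g1, g2⟩ := hgrid _ _ (hmem 0).1 (hmem 0).2
  refine ⟨(y 0).1 / N, (y 0).2 / N, g0, g1, g2, ⟨_, rfl⟩, ⟨_, rfl⟩, fun jstar => ?_⟩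
  obtain ⟨π, hπz, hπ, hsize⟩ := exists_assignment_of_labellings z k hcard
    (fun t : Fin 3 => l (y t).1 (y t).2)
    (fun j => by
      obtain ⟨t, ht⟩ := hrain (j + 1)
      have h := (hc (y t).1 (y t).2).2
      rw [ht, add_assoc, show (1 : Fin 3) + 2 = 0 from rfl, add_zero] at h
      exact ⟨t, h⟩)
    (fun j => by
      obtain ⟨t, ht⟩ := hrain j
      have h := (hc (y t).1 (y t).2).1
      rw [ht] at h
      exact ⟨t, h⟩) jstar
  refine ⟨π, hπz, fun i hi j => ?_, hsize⟩
  obtain ⟨t, ht⟩ := hπ i (ne_last i hi)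
  obtain ⟨t0, t1, t2⟩ := hgrid _ _ (hmem t).1 (hmem t).2
  have hbest := (hl (y t).1 (y t).2 i (hmem t).1 (hmem t).2).2 j
  rw [← ht] at hbest
  have hclose : ∀ m m' : ℕ, m ≤ m' + 1 → m' ≤ m + 1 → |(m / N : ℝ) - m' / N| ≤ 1 / N := by
    intro m m' h h'
    have h : (m : ℝ) ≤ m' + 1 := by exact_mod_cast h
    have h' : (m' : ℝ) ≤ m + 1 := by exact_mod_cast h'
    rw [← sub_div, abs_div, abs_of_pos hNR]
    gcongr
    rw [abs_le]
    constructor <;> linarith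
  have hvar : ∀ j', |v i (divB ((y 0).1 / N) ((y 0).2 / N) j') -
      v i (divB ((y t).1 / N) ((y t).2 / N) j')| ≤ 2 * (ε / 6) := by
    intro j'
    refine (abs_divB_sub_le hK (hlip i) g0 g1 g2 t0 t1 t2 j').trans ?_
    have e1 := hclose _ _ (hdist 0 t).1 (hdist t 0).1
    have e2 := hclose _ _ (hdist 0 t).2 (hdist t 0).2
    calc K * _ ≤ K * (1 / N + 1 / N) := by gcongr
      _ = 2 * (K / N) := by ring
      _ ≤ 2 * (ε / 6) := by gcongr
  have e1 := (abs_le.1 (hvar j)).2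
  have e2 := (abs_le.1 (hvar (π i))).1
  linarith
end
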